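/- arXiv:2205.14489 — 8 statements merged into one kernel-verified Lean document; each statement's English description precedes it below -/
import Mathlib

section
/- Let u : (0,1) → ℝ be twice differentiable and satisfy u''(x) + g(x)u'(x) + h(x)u(x) ≥ 0 for all x ∈ (0,1), where h(x) ≤ 0 on (0,1). If u attains its maximum over (0,1) at some point x₀ ∈ (0,1) with u(x₀) > 0 (i.e. u(x) ≤ u(x₀) for all x ∈ (0,1) and u(x₀) > 0), then u is constant on (0,1). -/
open Set

theorem no_max_aux (f : ℝ → ℝ) (p : ℝ) (hc : ContinuousAt f p) (h1 : IsLocalMax f p)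
    (h2 : 0 < deriv (deriv f) p) : False := by
  have h3 := isLocalMin_of_deriv_deriv_pos h2 h1.deriv_eq_zero hc
  have h4 : f =ᶠ[nhds p] fun _ => f p := by
    filter_upwards [h1, h3] with x hx hy
    exact le_antisymm hx hy
  have h5 := h4.deriv.deriv_eq
  simp at h5
  linarith

/-- If `u` is twice differentiable on `(0,1)` and satisfies
`u'' + g u' + h u ≥ 0` there with `h ≤ 0`, and `u` attains a positive maximum
over `(0,1)` at an interior point `x₀ ∈ (0,1)`, then `u` is constant on `(0,1)`. -/
theorem maximum_principle_interval
    (g h u : ℝ → ℝ)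
    (hg_bdd : ∀ a b : ℝ, 0 < a → b < 1 → a ≤ b → ∃ C : ℝ, ∀ x ∈ Icc a b, |g x| ≤ C ∧ |h x| ≤ C)
    (hdiff : ∀ x ∈ Ioo (0:ℝ) 1, DifferentiableAt ℝ u x ∧ DifferentiableAt ℝ (deriv u) x)
    (hh : ∀ x ∈ Ioo (0:ℝ) 1, h x ≤ 0)
    (hL : ∀ x ∈ Ioo (0:ℝ) 1,
      deriv (deriv u) x + g x * deriv u x + h x * u x ≥ 0)
    (x₀ : ℝ) (hx₀ : x₀ ∈ Ioo (0:ℝ) 1)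
    (hmax : ∀ x ∈ Ioo (0:ℝ) 1, u x ≤ u x₀)
    (hpos : 0 < u x₀) :
    ∀ x ∈ Ioo (0:ℝ) 1, u x = u x₀ := by
  intro d hd
  by_contra hne
  have hlt : u d < u x₀ := lt_of_le_of_ne (hmax d hd) hne
  have hcd : d ≠ x₀ := fun e => hne (by rw [e])
  have hsub : ∀ x ∈ uIcc x₀ d, x ∈ Ioo (0:ℝ) 1 := fun x hx =>
    ⟨lt_of_lt_of_le (lt_min hx₀.1 hd.1) hx.1, lt_of_le_of_lt hx.2 (max_lt hx₀.2 hd.2)⟩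
  obtain ⟨C, hC⟩ := hg_bdd (min x₀ d) (max x₀ d) (lt_min hx₀.1 hd.1) (max_lt hx₀.2 hd.2)
    min_le_max
  have hC0 : 0 ≤ C := le_trans (abs_nonneg _) (hC x₀ left_mem_uIcc).1
  obtain ⟨s, hs, hsd⟩ : ∃ s : ℝ, (s = 1 ∨ s = -1) ∧ 0 < s * (d - x₀) := by
    rcases lt_or_gt_of_ne hcd with h | h
    · exact ⟨-1, Or.inr rfl, by linarith⟩
    · exact ⟨1, Or.inl rfl, by linarith⟩
  obtain ⟨K, hK⟩ : ∃ K, K = s * (C + 1) := ⟨_, rfl⟩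
  have hK0 : K ≠ 0 := by rcases hs with h | h <;> subst h <;> intro h <;> linarith
  have hKpos : ∀ x ∈ uIcc x₀ d, 0 < K ^ 2 + g x * K + h x := by
    intro x hx
    obtain ⟨h1, h2⟩ := hC x hx
    rw [abs_le] at h1 h2
    rcases hs with h | h <;> subst h <;> subst hK <;> nlinarith
  have hzd : 0 < Real.exp (K * (d - x₀)) - 1 := by
    have : 0 < K * (d - x₀) := by
      rw [hK, mul_right_comm]; positivity
    have := Real.one_lt_exp_iff.2 this
    linarith
  obtain ⟨ε, hε, hεd⟩ : ∃ ε : ℝ, 0 < ε ∧ ε * (Real.exp (K * (d - x₀)) - 1) < u x₀ - u d := by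
    refine ⟨(u x₀ - u d) / 2 / (Real.exp (K * (d - x₀)) - 1), ?_, ?_⟩
    · have := sub_pos.2 hlt
      positivity
    · rw [div_mul_cancel₀ _ hzd.ne']; linarith
  obtain ⟨φ, hφ⟩ : ∃ φ : ℝ → ℝ, φ = fun x => u x + ε * (Real.exp (K * (x - x₀)) - 1) := ⟨_, rfl⟩
  have hE : ∀ x, HasDerivAt (fun x => Real.exp (K * (x - x₀))) (Real.exp (K * (x - x₀)) * K) x := by
    intro x
    have := (((hasDerivAt_id x).sub_const x₀).const_mul K).exp
    simpa using this
  have hφ1 : ∀ x ∈ Ioo (0:ℝ) 1,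
      HasDerivAt φ (deriv u x + ε * (Real.exp (K * (x - x₀)) * K)) x := by
    intro x hx
    rw [hφ]
    exact (hdiff x hx).1.hasDerivAt.add (((hE x).sub_const 1).const_mul ε)
  have hφ2 : ∀ x ∈ Ioo (0:ℝ) 1,
      deriv (deriv φ) x = deriv (deriv u) x + ε * (Real.exp (K * (x - x₀)) * K * K) := by
    intro x hx
    have he : deriv φ =ᶠ[nhds x] fun x => deriv u x + ε * (Real.exp (K * (x - x₀)) * K) := by
      filter_upwards [isOpen_Ioo.mem_nhds hx] with y hy
      exact (hφ1 y hy).deriv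
    rw [he.deriv_eq]
    exact ((hdiff x hx).2.hasDerivAt.add (((hE x).mul_const K).const_mul ε)).deriv
  have hφx₀ : φ x₀ = u x₀ := by simp [hφ]
  have hφd : φ d < u x₀ := by simp only [hφ]; linarith
  have hle : ∀ x ∈ uIcc x₀ d, φ x ≤ u x₀ := by
    obtain ⟨p, hp, hpm⟩ := isCompact_uIcc.exists_isMaxOn (nonempty_uIcc (a := x₀) (b := d))
      (f := φ) (fun x hx => (hφ1 x (hsub x hx)).continuousAt.continuousWithinAt)
    intro x hx
    refine le_trans (hpm hx) ?_
    by_contra! hgt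
    have hpI := hsub p hp
    have hp1 : p ≠ x₀ := by rintro rfl; linarith
    have hp2 : p ≠ d := by rintro rfl; linarith
    have hnh : uIcc x₀ d ∈ nhds p := by
      apply Icc_mem_nhds
      · refine lt_of_le_of_ne hp.1 ?_
        rcases min_choice x₀ d with h | h <;> rw [h]
        · exact hp1.symm
        · exact hp2.symm
      · refine lt_of_le_of_ne hp.2 ?_
        rcases max_choice x₀ d with h | h <;> rw [h]
        · exact hp1
        · exact hp2
    have hlm : IsLocalMax φ p := hpm.isLocalMax hnh
    have hd0 := hlm.deriv_eq_zero
    rw [(hφ1 p hpI).deriv] at hd0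
    refine no_max_aux φ p (hφ1 p hpI).continuousAt hlm ?_
    rw [hφ2 p hpI]
    have e1 := hL p hpI
    have e2 := mul_pos (mul_pos hε (Real.exp_pos (K * (p - x₀)))) (hKpos p hp)
    have e3 : h p * φ p ≤ 0 := mul_nonpos_of_nonpos_of_nonneg (hh p hpI) (by linarith)
    have e4 : ε * h p ≤ 0 := mul_nonpos_of_nonneg_of_nonpos hε.le (hh p hpI)
    have e5 : φ p = u p + ε * (Real.exp (K * (p - x₀)) - 1) := by rw [hφ]
    rw [e5] at e3
    have e6 : g p * (deriv u p + ε * (Real.exp (K * (p - x₀)) * K)) = 0 := by rw [hd0, mul_zero]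
    nlinarith
  have hloc : IsLocalMax φ x₀ := by
    filter_upwards [isOpen_Ioo.mem_nhds hx₀, Metric.ball_mem_nhds x₀ (abs_pos.2 (sub_ne_zero.2 hcd))]
      with x hx hxb
    rw [hφx₀]
    rw [Metric.mem_ball, Real.dist_eq] at hxb
    rcases le_or_gt (s * (x - x₀)) 0 with hsx | hsx
    · have : K * (x - x₀) ≤ 0 := by
        rw [hK, mul_right_comm]
        exact mul_nonpos_of_nonpos_of_nonneg hsx (by linarith)
      have h1 := Real.exp_le_one_iff.2 this
      have h2 := hmax x hx
      simp only [hφ]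
      nlinarith
    · apply hle
      rw [mem_uIcc]
      rcases hs with h | h <;> subst h
      · left
        rw [abs_of_pos (by linarith), abs_of_pos (by linarith)] at hxb
        constructor <;> linarith
      · right
        rw [abs_of_neg (by linarith), abs_of_neg (by linarith)] at hxb
        constructor <;> linarith
  have hu0 : deriv u x₀ = 0 := by
    apply IsLocalMax.deriv_eq_zero
    filter_upwards [isOpen_Ioo.mem_nhds hx₀] with x hx using hmax x hx
  have hfin := hloc.deriv_eq_zero
  rw [(hφ1 x₀ hx₀).deriv, hu0] at hfin
  simp at hfin
  rcases hfin with h | h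
  · exact hε.ne' h
  · exact hK0 h
end

section
/- One-dimensional Hopf lemma: let a < b be real numbers and let u : (a,b] → ℝ be continuous on (a,b], twice differentiable on (a,b), with a one-sided derivative u'(b) at b, satisfying u''(x) + g(x)u'(x) + h(x)u(x) ≥ 0 on (a,b), where h ≤ 0 and g, h are bounded on (a,b). Suppose u(x) ≤ u(b) for all x ∈ (a,b], that u(b) > 0, and that u is not constant on (a,b]. Then u'(b) > 0. -/
open Set

/-- One-dimensional Hopf lemma.  Let `a < b`, let `u` be continuous on
`(a,b]`, twice differentiable on `(a,b)`, with one-sided derivative `d` at `b`,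
satisfying `u'' + g u' + h u ≥ 0` on `(a,b)` where `h ≤ 0` and `g, h` are bounded
on `(a,b)`.  If `u ≤ u b` on `(a,b]`, `u b > 0`, and `u` is not constant on `(a,b]`,
then `d > 0`. -/
theorem hopf_lemma_one_dim
    (a b : ℝ) (hab : a < b) (g h u : ℝ → ℝ) (d : ℝ)
    (hcont : ContinuousOn u (Ioc a b))
    (hdiff : ∀ x ∈ Ioo a b, DifferentiableAt ℝ u x ∧ DifferentiableAt ℝ (deriv u) x)
    (hderiv_b : HasDerivWithinAt u d (Iic b) b)
    (hL : ∀ x ∈ Ioo a b, deriv (deriv u) x + g x * deriv u x + h x * u x ≥ 0)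
    (hh : ∀ x ∈ Ioo a b, h x ≤ 0)
    (hbdd : ∃ B : ℝ, ∀ x ∈ Ioo a b, |g x| ≤ B ∧ |h x| ≤ B)
    (hmax : ∀ x ∈ Ioc a b, u x ≤ u b)
    (hpos : 0 < u b)
    (hnonconst : ¬ (∀ x ∈ Ioc a b, u x = u b)) :
    0 < d := by
  obtain ⟨B, hB⟩ := hbdd
  push Not at hnonconst
  obtain ⟨c, hc, hne⟩ := hnonconst
  have huc : u c < u b := lt_of_le_of_ne (hmax c hc) hne
  have hcb : c < b := lt_of_le_of_ne hc.2 (fun e => hne (by rw [e]))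
  have hB0 : 0 ≤ B := le_trans (abs_nonneg _) (hB c ⟨hc.1, hcb⟩).1
  obtain ⟨K, hK⟩ : ∃ K, K = B + 2 := ⟨_, rfl⟩
  obtain ⟨ε, hε⟩ : ∃ ε, ε = (u b - u c) / Real.exp (K * (b - c)) := ⟨_, rfl⟩
  have hε0 : 0 < ε := by rw [hε]; exact div_pos (by linarith) (Real.exp_pos _)
  obtain ⟨v, hv⟩ : ∃ v : ℝ → ℝ, v = fun x => u x - u b + ε * (Real.exp (K * (b - x)) - 1) :=
    ⟨_, rfl⟩
  have hexp : ∀ x, HasDerivAt (fun x => Real.exp (K * (b - x))) (-K * Real.exp (K * (b - x))) x := by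
    intro x
    have h1 : HasDerivAt (fun x => K * (b - x)) (K * (-1)) x :=
      ((hasDerivAt_id x).const_sub b).const_mul K
    convert h1.exp using 1
    ring
  have hvb : v b = 0 := by simp [hv]
  have hvc : v c < 0 := by
    have : ε * Real.exp (K * (b - c)) = u b - u c := by
      rw [hε]; exact div_mul_cancel₀ _ (Real.exp_pos _).ne'
    simp only [hv]; linarith
  have hd1 : ∀ x ∈ Ioo a b, HasDerivAt v (deriv u x + ε * (-K * Real.exp (K * (b - x)))) x := by
    intro x hx
    rw [hv]
    exact ((hdiff x hx).1.hasDerivAt.sub_const _).add (((hexp x).sub_const 1).const_mul ε)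
  have hd2 : ∀ x ∈ Ioo a b, HasDerivAt (deriv v)
      (deriv (deriv u) x + ε * (-K * (-K * Real.exp (K * (b - x))))) x := by
    intro x hx
    have h1 : HasDerivAt (fun x => deriv u x + ε * (-K * Real.exp (K * (b - x))))
      (deriv (deriv u) x + ε * (-K * (-K * Real.exp (K * (b - x))))) x :=
      (hdiff x hx).2.hasDerivAt.add (((hexp x).const_mul (-K)).const_mul ε)
    refine h1.congr_of_eventuallyEq ?_
    filter_upwards [isOpen_Ioo.mem_nhds hx] with y hy
    exact (hd1 y hy).deriv
  have hvcont : ContinuousOn v (Icc c b) := by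
    rw [hv]
    have : ContinuousOn u (Icc c b) := hcont.mono (fun x hx => ⟨lt_of_lt_of_le hc.1 hx.1, hx.2⟩)
    fun_prop
  have hvle : ∀ x ∈ Icc c b, v x ≤ 0 := by
    obtain ⟨z, hz, hzmax⟩ := isCompact_Icc.exists_isMaxOn (nonempty_Icc.2 hcb.le) hvcont
    by_contra! hcon
    obtain ⟨y, hy, hy0⟩ := hcon
    have hz0 : 0 < v z := lt_of_lt_of_le hy0 (hzmax hy)
    have hzc : c < z := lt_of_le_of_ne hz.1 (fun e => by rw [← e] at hz0; linarith)
    have hzb : z < b := lt_of_le_of_ne hz.2 (fun e => by rw [e] at hz0; linarith)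
    have hzI : z ∈ Ioo a b := ⟨hc.1.trans hzc, hzb⟩
    have hloc : IsLocalMax v z := hzmax.isLocalMax (Icc_mem_nhds hzc hzb)
    have hv1 : deriv v z = 0 := hloc.deriv_eq_zero
    have e1 := (hd1 z hzI).deriv
    have e2 := (hd2 z hzI).deriv
    have hLz := hL z hzI
    have hhz := hh z hzI
    obtain ⟨hg1, hh1⟩ := hB z hzI
    have hE : 0 < Real.exp (K * (b - z)) := Real.exp_pos _
    have hvz : v z = u z - u b + ε * (Real.exp (K * (b - z)) - 1) := by rw [hv]
    generalize Real.exp (K * (b - z)) = E at *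
    have hq : 0 < K ^ 2 - g z * K + h z := by
      have := (abs_le.1 hg1).2
      have := (abs_le.1 hh1).1
      rw [hK]
      nlinarith
    have hpp : 0 < deriv (deriv v) z := by
      have h1 : 0 < ε * (E * (K ^ 2 - g z * K + h z)) := by positivity
      have h2 : 0 ≤ -h z * v z := mul_nonneg (by linarith) hz0.le
      have h3 : 0 ≤ -h z * u b := mul_nonneg (by linarith) hpos.le
      have h4 : 0 ≤ -h z * ε := mul_nonneg (by linarith) hε0.le
      have h5 : deriv u z = ε * (K * E) := by linarith
      rw [h5] at hLz
      rw [hvz] at h2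
      rw [e2]
      nlinarith
    have hmin := isLocalMin_of_deriv_deriv_pos hpp hv1 (hd1 z hzI).continuousAt
    have hconst : v =ᶠ[nhds z] fun _ => v z := by
      filter_upwards [hloc, hmin] with y h1 h2
      exact le_antisymm h1 h2
    have := hconst.deriv.deriv_eq
    simp at this
    linarith
  have hvd : HasDerivWithinAt v (d + ε * (-K * Real.exp (K * (b - b)))) (Iio b) b := by
    rw [hv]
    exact ((hderiv_b.mono Iio_subset_Iic_self).sub_const _).add
      (((hexp b).hasDerivWithinAt.sub_const 1).const_mul ε)
  rw [hasDerivWithinAt_iff_tendsto_slope' (by simp)] at hvd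
  have hge : 0 ≤ d + ε * (-K * Real.exp (K * (b - b))) := by
    refine ge_of_tendsto hvd ?_
    filter_upwards [Ioo_mem_nhdsLT hcb] with x hx
    rw [slope_def_field, hvb]
    exact div_nonneg_of_nonpos (by linarith [hvle x ⟨hx.1.le, hx.2.le⟩]) (by linarith [hx.2])
  have : 0 < ε * K := mul_pos hε0 (by linarith)
  simp at hge
  linarith
end

section
/- Generalized maximum principle (first part of the Proposition): let u, φ : (0,1) → ℝ be twice differentiable, with Lu(x) ≥ 0 for all x ∈ (0,1), φ(x) > 0 for all x ∈ (0,1), and Lφ(x) ≤ 0 for all x ∈ (0,1). If the quotient u/φ attains its maximum over (0,1) at some point x₀ ∈ (0,1) with u(x₀)/φ(x₀) > 0, then u/φ is constant on (0,1). -/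
open Set

lemma gmp_aux (a b C : ℝ) (hab : a ≤ b) (hC : 0 ≤ C) (v v1 v2 : ℝ → ℝ)
    (h1 : ∀ x ∈ Icc a b, HasDerivAt v (v1 x) x)
    (h2 : ∀ x ∈ Icc a b, HasDerivAt v1 (v2 x) x)
    (hv : ∀ x ∈ Icc a b, 0 ≤ v x)
    (hineq : ∀ x ∈ Icc a b, v2 x ≤ C * |v1 x| + C * v x)
    (ha : v a = 0) (ha1 : v1 a = 0) : v b = 0 := by
  set k : ℝ := 2 * C + 1 with hk
  have hf : ∀ x ∈ Icc a b, HasDerivAt (fun y => v1 y + k * v y) (v2 x + k * v1 x) x :=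
    fun x hx => (h2 x hx).add ((h1 x hx).const_mul k)
  have key : ∀ x ∈ Icc a b, v1 x + k * v x ≤ 0 := by
    intro x hx
    have hB : ∀ ε : ℝ, 0 < ε → v1 x + k * v x ≤ ε * Real.exp ((k + 2 * C + 1) * (x - a)) := by
      intro ε hε
      have hBd : ∀ y : ℝ, HasDerivAt (fun y => ε * Real.exp ((k + 2 * C + 1) * (y - a)))
          (ε * (Real.exp ((k + 2 * C + 1) * (y - a)) * ((k + 2 * C + 1) * 1))) y := fun y =>
        ((((hasDerivAt_id y).sub_const a).const_mul (k + 2 * C + 1)).exp).const_mul ε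
      refine image_le_of_deriv_right_lt_deriv_boundary
        (f := fun y => v1 y + k * v y) (f' := fun y => v2 y + k * v1 y)
        (fun y hy => (hf y hy).continuousAt.continuousWithinAt)
        (fun y hy => (hf y (Ico_subset_Icc_self hy)).hasDerivWithinAt) ?_ hBd ?_ hx
      · simp [ha, ha1, hε.le]
      · intro y hy heq
        have hy' := Ico_subset_Icc_self hy
        have i1 := hineq y hy'
        have i2 := hv y hy'
        have hpos : 0 < ε * Real.exp ((k + 2 * C + 1) * (y - a)) := by positivity
        have e2 : ε * (Real.exp ((k + 2 * C + 1) * (y - a)) * ((k + 2 * C + 1) * 1))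
          = (k + 2 * C + 1) * (ε * Real.exp ((k + 2 * C + 1) * (y - a))) := by ring
        rw [e2]
        generalize ε * Real.exp ((k + 2 * C + 1) * (y - a)) = B at *
        generalize v y = p at *
        generalize v1 y = q at *
        have hCp : 0 ≤ C * p := by positivity
        have hCCp : 0 ≤ C * (C * p) := by positivity
        have hCB : 0 ≤ C * B := by positivity
        rcases le_total 0 q with hq | hq
        · rw [abs_of_nonneg hq] at i1
          have hCq : 0 ≤ C * q := by positivity
          subst heq
          rw [hk] at *
          nlinarith [mul_nonneg hC hCq]
        · rw [abs_of_nonpos hq] at i1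
          have hqe : q = B - k * p := by linarith
          subst hqe
          rw [hk] at *
          nlinarith
    have ht : 0 < Real.exp ((k + 2 * C + 1) * (x - a)) := Real.exp_pos _
    refine le_of_forall_pos_le_add fun δ hδ => ?_
    have := hB (δ / Real.exp ((k + 2 * C + 1) * (x - a))) (by positivity)
    rw [div_mul_cancel₀ _ ht.ne'] at this
    linarith
  have hE : ∀ x ∈ Icc a b, HasDerivAt (fun y => v y * Real.exp (k * y))
      (v1 x * Real.exp (k * x) + v x * (Real.exp (k * x) * (k * 1))) x := fun x hx =>
    (h1 x hx).mul (((hasDerivAt_id x).const_mul k).exp)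
  have hanti : AntitoneOn (fun y => v y * Real.exp (k * y)) (Icc a b) := by
    refine antitoneOn_of_deriv_nonpos (convex_Icc a b)
      (fun y hy => (hE y hy).continuousAt.continuousWithinAt)
      (fun y hy => (hE y (interior_subset hy)).differentiableAt.differentiableWithinAt) ?_
    intro y hy
    rw [(hE y (interior_subset hy)).deriv]
    have := key y (interior_subset hy)
    have ht := Real.exp_pos (k * y)
    nlinarith
  have h3 := hanti (left_mem_Icc.2 hab) (right_mem_Icc.2 hab) hab
  simp only [ha, zero_mul] at h3
  have ht := Real.exp_pos (k * b)
  have h4 := hv b (right_mem_Icc.2 hab)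
  nlinarith

/-- Generalized maximum principle.  Let `u, φ` be twice differentiable
on `(0,1)` with `Lu ≥ 0`, `φ > 0`, `Lφ ≤ 0` on `(0,1)`.  If the quotient `u/φ`
attains its maximum over `(0,1)` at some `x₀ ∈ (0,1)` with `u x₀ / φ x₀ > 0`,
then `u/φ` is constant on `(0,1)`. -/
theorem generalized_maximum_principle
    (g h u φ : ℝ → ℝ)
    (hg_bdd : ∀ a b : ℝ, 0 < a → b < 1 → a ≤ b → ∃ C : ℝ, ∀ x ∈ Icc a b, |g x| ≤ C ∧ |h x| ≤ C)
    (hu : ∀ x ∈ Ioo (0:ℝ) 1, DifferentiableAt ℝ u x ∧ DifferentiableAt ℝ (deriv u) x)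
    (hφ : ∀ x ∈ Ioo (0:ℝ) 1, DifferentiableAt ℝ φ x ∧ DifferentiableAt ℝ (deriv φ) x)
    (hLu : ∀ x ∈ Ioo (0:ℝ) 1, deriv (deriv u) x + g x * deriv u x + h x * u x ≥ 0)
    (hφpos : ∀ x ∈ Ioo (0:ℝ) 1, 0 < φ x)
    (hLφ : ∀ x ∈ Ioo (0:ℝ) 1, deriv (deriv φ) x + g x * deriv φ x + h x * φ x ≤ 0)
    (x₀ : ℝ) (hx₀ : x₀ ∈ Ioo (0:ℝ) 1)
    (hmax : ∀ x ∈ Ioo (0:ℝ) 1, u x / φ x ≤ u x₀ / φ x₀)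
    (hpos : 0 < u x₀ / φ x₀) :
    ∀ x ∈ Ioo (0:ℝ) 1, u x / φ x = u x₀ / φ x₀ := by
  set M := u x₀ / φ x₀ with hM
  set v : ℝ → ℝ := fun y => M * φ y - u y with hv
  set v1 : ℝ → ℝ := fun y => M * deriv φ y - deriv u y with hv1
  set v2 : ℝ → ℝ := fun y => M * deriv (deriv φ) y - deriv (deriv u) y with hv2
  have d1 : ∀ x ∈ Ioo (0:ℝ) 1, HasDerivAt v (v1 x) x := fun x hx =>
    ((hφ x hx).1.hasDerivAt.const_mul M).sub (hu x hx).1.hasDerivAt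
  have d2 : ∀ x ∈ Ioo (0:ℝ) 1, HasDerivAt v1 (v2 x) x := fun x hx =>
    ((hφ x hx).2.hasDerivAt.const_mul M).sub (hu x hx).2.hasDerivAt
  have hv0 : ∀ x ∈ Ioo (0:ℝ) 1, 0 ≤ v x := fun x hx => by
    have := (div_le_iff₀ (hφpos x hx)).1 (hmax x hx)
    simp only [hv]; linarith
  have hvx : v x₀ = 0 := by
    have := (hφpos x₀ hx₀).ne'
    simp only [hv, hM]; field_simp; ring
  have hv1x : v1 x₀ = 0 := by
    refine IsLocalMin.hasDerivAt_eq_zero ?_ (d1 x₀ hx₀)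
    filter_upwards [isOpen_Ioo.mem_nhds hx₀] with y hy
    rw [hvx]; exact hv0 y hy
  have hineq : ∀ a b : ℝ, 0 < a → b < 1 → a ≤ b → ∃ C : ℝ, 0 ≤ C ∧
      ∀ x ∈ Icc a b, v2 x ≤ C * |v1 x| + C * v x := by
    intro a b ha hb hab
    obtain ⟨C, hC⟩ := hg_bdd a b ha hb hab
    refine ⟨C, (abs_nonneg _).trans (hC a (left_mem_Icc.2 hab)).1, fun x hx => ?_⟩
    have hx' : x ∈ Ioo (0:ℝ) 1 := ⟨ha.trans_le hx.1, hx.2.trans_lt hb⟩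
    have e1 : v2 x + g x * v1 x + h x * v x ≤ 0 := by
      have := mul_nonneg hpos.le (sub_nonneg.2 (hLφ x hx'))
      have := hLu x hx'
      simp only [hv, hv1, hv2]; linarith
    have e2 : -(g x * v1 x) ≤ C * |v1 x| := by
      refine (neg_le_abs _).trans ?_
      rw [abs_mul]
      exact mul_le_mul_of_nonneg_right (hC x hx).1 (abs_nonneg _)
    have e3 : -(h x * v x) ≤ C * v x := by
      rw [← neg_mul]
      exact mul_le_mul_of_nonneg_right ((neg_le_abs _).trans (hC x hx).2) (hv0 x hx')
    linarith
  intro x hx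
  suffices hvz : v x = 0 by
    rw [div_eq_iff (hφpos x hx).ne']
    simp only [hv] at hvz; linarith
  rcases le_total x₀ x with hle | hle
  · obtain ⟨C, hC0, hC⟩ := hineq x₀ x hx₀.1 hx.2 hle
    have hsub : ∀ y ∈ Icc x₀ x, y ∈ Ioo (0:ℝ) 1 := fun y hy =>
      ⟨hx₀.1.trans_le hy.1, hy.2.trans_lt hx.2⟩
    exact gmp_aux x₀ x C hle hC0 v v1 v2 (fun y hy => d1 y (hsub y hy))
      (fun y hy => d2 y (hsub y hy)) (fun y hy => hv0 y (hsub y hy)) hC hvx hv1x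
  · obtain ⟨C, hC0, hC⟩ := hineq x x₀ hx.1 hx₀.2 hle
    have hneg : ∀ y ∈ Icc (-x₀) (-x), -y ∈ Icc x x₀ := fun y hy =>
      ⟨by linarith [hy.2], by linarith [hy.1]⟩
    have hsub : ∀ y ∈ Icc x x₀, y ∈ Ioo (0:ℝ) 1 := fun y hy =>
      ⟨hx.1.trans_le hy.1, hy.2.trans_lt hx₀.2⟩
    have := gmp_aux (-x₀) (-x) C (by linarith) hC0 (fun y => v (-y)) (fun y => -v1 (-y))
      (fun y => v2 (-y))
      (fun y hy => by
        have := (d1 (-y) (hsub _ (hneg y hy))).comp y (hasDerivAt_neg y)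
        simpa [Function.comp_def] using this)
      (fun y hy => by
        have := ((d2 (-y) (hsub _ (hneg y hy))).comp y (hasDerivAt_neg y)).neg
        rw [mul_neg_one, neg_neg] at this
        exact this)
      (fun y hy => hv0 _ (hsub _ (hneg y hy)))
      (fun y hy => by simpa only [abs_neg] using hC _ (hneg y hy))
      (by simpa only [neg_neg] using hvx) (by simp only [neg_neg, hv1x, neg_zero])
    simpa only [neg_neg] using this
end

section
/- Euler–Poisson–Darboux equation in Euclidean space: let n ≥ 2 and let f : ℝⁿ → ℝ be a C² function. Then for every x ∈ ℝⁿ and r > 0, the spherical mean I_f(x,r) is twice differentiable in r and satisfies ∂²I_f/∂r²(x,r) + ((n−1)/r)·∂I_f/∂r(x,r) = I_{Δf}(x,r), the spherical mean of Δf over the same sphere. -/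
open MeasureTheory Metric Set Filter

/-- Mean value of `f` over the sphere `∂B_r(x)` in `ℝⁿ`, with respect to the
`(n-1)`-dimensional Hausdorff (surface) measure. -/
noncomputable def sphericalMean {n : ℕ} (f : EuclideanSpace ℝ (Fin n) → ℝ)
    (x : EuclideanSpace ℝ (Fin n)) (r : ℝ) : ℝ :=
  ⨍ y in sphere x r, f y ∂(μH[(n : ℝ) - 1])

/-- The Euclidean Laplacian: sum of second partial derivatives. -/
noncomputable def lap {n : ℕ} (f : EuclideanSpace ℝ (Fin n) → ℝ)
    (x : EuclideanSpace ℝ (Fin n)) : ℝ :=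
  ∑ i : Fin n, fderiv ℝ (fun y => fderiv ℝ f y (EuclideanSpace.single i 1)) x
      (EuclideanSpace.single i 1)

open scoped Topology Pointwise

namespace EPD

/-- Differentiation under the integral sign over a compact set. -/
lemma hasDerivAt_integral_compact {E : Type*} [NormedAddCommGroup E] [NormedSpace ℝ E]
    [FiniteDimensional ℝ E] [MeasurableSpace E] [BorelSpace E]
    (ν : Measure E) [IsFiniteMeasure ν] (K : Set E) (hK : IsCompact K)
    (hν : ∀ᵐ w ∂ν, w ∈ K) (F F' : ℝ → E → ℝ)
    (hF : ∀ t, Continuous (F t)) (hF' : Continuous (fun p : ℝ × E => F' p.1 p.2))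
    (hd : ∀ t w, HasDerivAt (fun s => F s w) (F' t w) t) (t : ℝ) :
    HasDerivAt (fun s => ∫ w, F s w ∂ν) (∫ w, F' t w ∂ν) t := by
  obtain ⟨C, hC⟩ := ((isCompact_closedBall t 1).prod hK).exists_bound_of_continuousOn
    hF'.continuousOn
  obtain ⟨C0, hC0⟩ := hK.exists_bound_of_continuousOn (hF t).continuousOn
  refine (hasDerivAt_integral_of_dominated_loc_of_deriv_le (μ := ν) (F := F) (F' := F')
    (bound := fun _ => C) (s := closedBall t 1) (x₀ := t) (closedBall_mem_nhds t one_pos)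
    (Eventually.of_forall fun s => (hF s).aestronglyMeasurable) ?_ ?_ ?_
    (integrable_const C) (Eventually.of_forall fun w s _ => hd s w)).2
  · refine Integrable.of_bound (hF t).aestronglyMeasurable C0 ?_
    filter_upwards [hν] with w hw using hC0 w hw
  · exact (hF'.comp (Continuous.prodMk_right t)).aestronglyMeasurable
  · filter_upwards [hν] with w hw s hs using hC (s, w) ⟨hs, hw⟩

lemma integrable_compact {E : Type*} [NormedAddCommGroup E] [NormedSpace ℝ E]
    [FiniteDimensional ℝ E] [MeasurableSpace E] [BorelSpace E]
    (ν : Measure E) [IsFiniteMeasure ν] (K : Set E) (hK : IsCompact K)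
    (hν : ∀ᵐ w ∂ν, w ∈ K) (F : E → ℝ) (hF : Continuous F) : Integrable F ν := by
  obtain ⟨C0, hC0⟩ := hK.exists_bound_of_continuousOn hF.continuousOn
  refine Integrable.of_bound hF.aestronglyMeasurable C0 ?_
  filter_upwards [hν] with w hw using hC0 w hw

/-- Infinitesimal rotations integrate to zero against a rotation invariant measure. -/
lemma integral_rot {E : Type*} [NormedAddCommGroup E] [InnerProductSpace ℝ E]
    [FiniteDimensional ℝ E] [MeasurableSpace E] [BorelSpace E]
    (ν : Measure E) [IsFiniteMeasure ν] (K : Set E) (hK : IsCompact K)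
    (hν : ∀ᵐ w ∂ν, w ∈ K) (hinv : ∀ R : E ≃ₗᵢ[ℝ] E, MeasurePreserving R ν ν)
    (A : E →L[ℝ] E) (hA : A ∈ skewAdjoint (E →L[ℝ] E))
    (h : E → ℝ) (hh : ContDiff ℝ 1 h) :
    ∫ w, fderiv ℝ h w (A w) ∂ν = 0 := by
  have hexp : Continuous (fun t : ℝ => NormedSpace.exp (t • A)) :=
    continuous_iff_continuousAt.2 fun t => (hasDerivAt_exp_smul_const A t).continuousAt
  have hdh : Continuous (fderiv ℝ h) := hh.continuous_fderiv one_ne_zero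
  have key := hasDerivAt_integral_compact ν K hK hν
    (fun t w => h (NormedSpace.exp (t • A) w))
    (fun t w => fderiv ℝ h (NormedSpace.exp (t • A) w) ((NormedSpace.exp (t • A) * A) w))
    (fun t => hh.continuous.comp (ContinuousLinearMap.continuous _))
    (by
      have h1 : Continuous (fun p : ℝ × E => NormedSpace.exp (p.1 • A) p.2) :=
        (hexp.comp continuous_fst).clm_apply continuous_snd
      have h2 : Continuous (fun p : ℝ × E => (NormedSpace.exp (p.1 • A) * A) p.2) :=
        ((hexp.comp continuous_fst).mul continuous_const).clm_apply continuous_snd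
      exact (hdh.comp h1).clm_apply h2)
    (by
      intro t w
      have h1 : HasDerivAt (fun s : ℝ => NormedSpace.exp (s • A) w)
          ((NormedSpace.exp (t • A) * A) w) t := by
        simpa using (hasDerivAt_exp_smul_const A t).clm_apply (hasDerivAt_const t w)
      exact ((hh.differentiable one_ne_zero _).hasFDerivAt).comp_hasDerivAt t h1) 0
  have hc : (fun t : ℝ => ∫ w, h (NormedSpace.exp (t • A) w) ∂ν) = fun _ => ∫ w, h w ∂ν := by
    funext t
    let _ : NormedAlgebra ℚ (E →L[ℝ] E) := NormedAlgebra.restrictScalars ℚ ℝ (E →L[ℝ] E)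
    have hu : NormedSpace.exp (t • A) ∈ unitary (E →L[ℝ] E) :=
      NormedSpace.exp_mem_unitary_of_mem_skewAdjoint (skewAdjoint.smul_mem t hA)
    let R := Unitary.linearIsometryEquiv ⟨_, hu⟩
    exact (hinv R).integral_comp R.toHomeomorph.measurableEmbedding h
  rw [hc] at key
  have := key.unique (hasDerivAt_const (0:ℝ) (∫ w, h w ∂ν))
  simpa using this

lemma integral_rot_sq {E : Type*} [NormedAddCommGroup E] [InnerProductSpace ℝ E]
    [FiniteDimensional ℝ E] [MeasurableSpace E] [BorelSpace E]
    (ν : Measure E) [IsFiniteMeasure ν] (K : Set E) (hK : IsCompact K)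
    (hν : ∀ᵐ w ∂ν, w ∈ K) (hinv : ∀ R : E ≃ₗᵢ[ℝ] E, MeasurePreserving R ν ν)
    (A : E →L[ℝ] E) (hA : A ∈ skewAdjoint (E →L[ℝ] E))
    (f : E → ℝ) (hf : ContDiff ℝ 2 f) (x : E) (r : ℝ) :
    ∫ w, (r * fderiv ℝ (fderiv ℝ f) (x + r • w) (A w) (A w)
      + fderiv ℝ f (x + r • w) (A (A w))) ∂ν = 0 := by
  have hdf : ContDiff ℝ 1 (fderiv ℝ f) := hf.fderiv_right (by norm_num)
  have hφ : ContDiff ℝ 1 (fun w : E => x + r • w) := by fun_prop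
  have hh : ContDiff ℝ 1 (fun w => fderiv ℝ f (x + r • w) (A w)) :=
    (hdf.comp hφ).clm_apply A.contDiff
  rw [← integral_rot ν K hK hν hinv A hA _ hh]
  congr 1
  funext w
  have h0 : HasFDerivAt (fun w : E => x + r • w) (r • ContinuousLinearMap.id ℝ E) w :=
    ((hasFDerivAt_id w).const_smul r).const_add x
  have h1 := ((hdf.differentiable one_ne_zero (x + r • w)).hasFDerivAt).comp w h0
  have h2 := h1.clm_apply (A.hasFDerivAt (x := w))
  have h3 := h2.fderiv
  simp only [Function.comp_def] at h3
  rw [h3]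
  simp
  ring

/-- The generator of rotations in the plane `(i, j)`. -/
noncomputable def gen {n : ℕ} (i j : Fin n) :
    EuclideanSpace ℝ (Fin n) →L[ℝ] EuclideanSpace ℝ (Fin n) :=
  (EuclideanSpace.proj i : EuclideanSpace ℝ (Fin n) →L[ℝ] ℝ).smulRight (EuclideanSpace.single j 1)
  - (EuclideanSpace.proj j : EuclideanSpace ℝ (Fin n) →L[ℝ] ℝ).smulRight
      (EuclideanSpace.single i 1)

lemma gen_apply {n : ℕ} (i j : Fin n) (w : EuclideanSpace ℝ (Fin n)) :
    gen i j w = w i • EuclideanSpace.single j (1:ℝ) - w j • EuclideanSpace.single i (1:ℝ) := by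
  simp [gen]

lemma gen_skew {n : ℕ} (i j : Fin n) :
    gen i j ∈ skewAdjoint (EuclideanSpace ℝ (Fin n) →L[ℝ] EuclideanSpace ℝ (Fin n)) := by
  rw [skewAdjoint.mem_iff, ContinuousLinearMap.star_eq_adjoint, eq_comm,
    ContinuousLinearMap.eq_adjoint_iff]
  intro v w
  simp only [neg_apply, gen_apply, inner_neg_left, inner_sub_left,
    inner_sub_right, inner_smul_left, inner_smul_right, EuclideanSpace.inner_single_left,
    EuclideanSpace.inner_single_right]
  simp
  ring

lemma gen_gen {n : ℕ} (i j : Fin n) (w : EuclideanSpace ℝ (Fin n)) :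
    gen i j (gen i j w) = -(w i • EuclideanSpace.single i (1:ℝ))
      - w j • EuclideanSpace.single j (1:ℝ)
      + (if i = j then (2 * w i) • EuclideanSpace.single i (1:ℝ) else 0) := by
  by_cases hij : i = j
  · subst hij
    simp [gen_apply, two_mul, add_smul]
  · simp [gen_apply, hij, Ne.symm hij, eq_comm]
    abel

lemma sum_single {n : ℕ} (w : EuclideanSpace ℝ (Fin n)) :
    ∑ i, w i • EuclideanSpace.single i (1:ℝ) = w := by
  ext k
  simp [Pi.single_apply]

lemma algebra_id {n : ℕ} (w : EuclideanSpace ℝ (Fin n)) (hw : ‖w‖ = 1)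
    (B : EuclideanSpace ℝ (Fin n) →L[ℝ] EuclideanSpace ℝ (Fin n) →L[ℝ] ℝ)
    (l : EuclideanSpace ℝ (Fin n) →L[ℝ] ℝ) (r : ℝ) :
    ∑ i, ∑ j, (r * B (gen i j w) (gen i j w) + l (gen i j (gen i j w)))
      = 2 * (r * ∑ i, B (EuclideanSpace.single i 1) (EuclideanSpace.single i 1)
        - r * B w w - ((n : ℝ) - 1) * l w) := by
  have hn : ∑ i, w i ^ 2 = 1 := by
    have := EuclideanSpace.real_norm_sq_eq w
    rw [hw] at this
    simpa using this.symm
  have hl : ∑ i, w i * l (EuclideanSpace.single i 1) = l w := by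
    conv_rhs => rw [← sum_single w]
    simp
  have hB : ∑ i, ∑ j, w i * w j * B (EuclideanSpace.single i 1) (EuclideanSpace.single j 1)
      = B w w := by
    conv_rhs => rw [← sum_single w]
    simp [Finset.mul_sum, mul_assoc]
    rw [Finset.sum_comm]
    simp_rw [mul_left_comm]
  have hB' : ∑ i, ∑ j, w i * w j * B (EuclideanSpace.single j 1) (EuclideanSpace.single i 1)
      = B w w := by
    rw [← hB, Finset.sum_comm]
    simp_rw [mul_comm (w _) (w _)]
  have e1 : ∑ i : Fin n, ∑ j, w i ^ 2 * B (EuclideanSpace.single j 1) (EuclideanSpace.single j 1)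
      = ∑ i, B (EuclideanSpace.single i 1) (EuclideanSpace.single i 1) := by
    simp_rw [← Finset.mul_sum]
    rw [← Finset.sum_mul, hn, one_mul]
  have e2 : ∑ i : Fin n, ∑ j, w j ^ 2 * B (EuclideanSpace.single i 1) (EuclideanSpace.single i 1)
      = ∑ i, B (EuclideanSpace.single i 1) (EuclideanSpace.single i 1) := by
    rw [Finset.sum_comm, e1]
  have e3 : ∑ i : Fin n, ∑ _j : Fin n, w i * l (EuclideanSpace.single i 1) = n * l w := by
    simp [← Finset.mul_sum, hl]
  have e4 : ∑ _i : Fin n, ∑ j : Fin n, w j * l (EuclideanSpace.single j 1) = n * l w := by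
    simp [hl]
  have e5 : ∑ i : Fin n, ∑ j : Fin n,
      (if i = j then 2 * (w i * l (EuclideanSpace.single i 1)) else 0) = 2 * l w := by
    simp [← Finset.mul_sum, hl]
  have term : ∀ i j, r * B (gen i j w) (gen i j w) + l (gen i j (gen i j w))
      = r * (w i ^ 2 * B (EuclideanSpace.single j 1) (EuclideanSpace.single j 1))
      + r * (w j ^ 2 * B (EuclideanSpace.single i 1) (EuclideanSpace.single i 1))
      - r * (w i * w j * B (EuclideanSpace.single i 1) (EuclideanSpace.single j 1))
      - r * (w i * w j * B (EuclideanSpace.single j 1) (EuclideanSpace.single i 1))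
      - w i * l (EuclideanSpace.single i 1) - w j * l (EuclideanSpace.single j 1)
      + (if i = j then 2 * (w i * l (EuclideanSpace.single i 1)) else 0) := by
    intro i j
    rw [gen_gen, gen_apply]
    split_ifs <;> simp <;> ring
  have pull : ∀ F : Fin n → Fin n → ℝ, ∑ i, ∑ j, r * F i j = r * ∑ i, ∑ j, F i j := by
    intro F
    simp_rw [Finset.mul_sum]
  simp_rw [term, Finset.sum_add_distrib, Finset.sum_sub_distrib, Finset.sum_add_distrib]
  rw [pull, pull, pull, pull, e1, e2, hB, hB', e3, e4, e5]
  ring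

/-- Normalized surface measure of the unit sphere. -/
noncomputable def nu (n : ℕ) : Measure (EuclideanSpace ℝ (Fin n)) :=
  ((μH[(n : ℝ) - 1] : Measure (EuclideanSpace ℝ (Fin n))).restrict (sphere 0 1) univ)⁻¹ •
    (μH[(n : ℝ) - 1] : Measure (EuclideanSpace ℝ (Fin n))).restrict (sphere 0 1)

instance (n : ℕ) : IsFiniteMeasure (nu n) :=
  ⟨lt_of_le_of_lt (by
    rw [nu, Measure.smul_apply, smul_eq_mul]
    exact ENNReal.inv_mul_le_one _) ENNReal.one_lt_top⟩

lemma nu_ae (n : ℕ) : ∀ᵐ w ∂(nu n), w ∈ sphere (0 : EuclideanSpace ℝ (Fin n)) 1 :=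
  Measure.ae_smul_measure (ae_restrict_mem isClosed_sphere.measurableSet) _

lemma nu_inv (n : ℕ) (R : EuclideanSpace ℝ (Fin n) ≃ₗᵢ[ℝ] EuclideanSpace ℝ (Fin n)) :
    MeasurePreserving R (nu n) (nu n) := by
  have h := R.toIsometryEquiv.measurePreserving_hausdorffMeasure ((n : ℝ) - 1)
  have h2 := h.restrict_preimage (isClosed_sphere (x := (0 : EuclideanSpace ℝ (Fin n)))
    (ε := 1)).measurableSet
  have h3 : (R.toIsometryEquiv ⁻¹' sphere (0 : EuclideanSpace ℝ (Fin n)) 1) = sphere 0 1 := by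
    ext w; simp
  rw [h3] at h2
  exact h2.smul_measure _

lemma mean_eq {n : ℕ} (hn : 2 ≤ n) (f : EuclideanSpace ℝ (Fin n) → ℝ)
    (x : EuclideanSpace ℝ (Fin n)) (s : ℝ) (hs : 0 < s) :
    sphericalMean f x s = ∫ w, f (x + s • w) ∂(nu n) := by
  have hd : 0 ≤ (n : ℝ) - 1 := by
    have : (2:ℝ) ≤ n := by exact_mod_cast hn
    linarith
  set d := (n : ℝ) - 1 with hdd
  let φ : EuclideanSpace ℝ (Fin n) ≃ₜ EuclideanSpace ℝ (Fin n) :=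
    (Homeomorph.smulOfNeZero s hs.ne').trans (Homeomorph.addLeft x)
  have hφ : ∀ w, φ w = x + s • w := fun w => rfl
  have himg : ∀ T : Set (EuclideanSpace ℝ (Fin n)), μH[d] (φ '' T) = (‖s‖₊ ^ d) • μH[d] T := by
    intro T
    have : φ '' T = (IsometryEquiv.addLeft x) '' (s • T) := by
      rw [← Set.image_smul, Set.image_image]; rfl
    rw [this, IsometryEquiv.hausdorffMeasure_image, Measure.hausdorffMeasure_smul₀ hd hs.ne']
  set c : NNReal := ‖s‖₊ ^ d with hc
  have hc0 : c ≠ 0 := by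
    have : 0 < ‖s‖₊ := by simpa using hs.ne'
    exact (NNReal.rpow_pos this).ne'
  have hmeas : (μH[d]).restrict (sphere x s) = c • ((μH[d]).restrict (sphere 0 1)).map φ := by
    ext T hT
    rw [Measure.restrict_apply hT, Measure.smul_apply, Measure.map_apply φ.measurable hT,
      Measure.restrict_apply (φ.measurable hT), ← himg]
    congr 1
    rw [Set.inter_comm (φ ⁻¹' T), Set.image_inter_preimage, Set.inter_comm]
    congr 1
    ext y
    rw [← φ.coe_toEquiv, Equiv.image_eq_preimage_symm] 
    have : y = φ (φ.symm y) := (φ.apply_symm_apply y).symm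
    simp only [mem_preimage, mem_sphere, dist_eq_norm, sub_zero]
    conv_lhs => rw [this, hφ, add_sub_cancel_left, norm_smul, Real.norm_of_nonneg hs.le]
    constructor
    · intro h; exact mul_left_cancel₀ hs.ne' (by simpa using h)
    · intro h
      have h' : ‖φ.symm y‖ = 1 := h
      rw [h', mul_one]
  have hfin : sphericalMean f x s =
      ⨍ w in sphere (0 : EuclideanSpace ℝ (Fin n)) 1, f (x + s • w) ∂(μH[d]) := by
    rw [sphericalMean, ← hdd, hmeas, average_eq, average_eq, integral_smul_nnreal_measure,
      φ.measurableEmbedding.integral_map]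
    simp only [hφ, measureReal_def, Measure.smul_apply,
      Measure.map_apply φ.measurable MeasurableSet.univ, preimage_univ]
    have hc0' : (c:ℝ) ≠ 0 := by exact_mod_cast hc0
    rw [ENNReal.smul_def, smul_eq_mul, smul_eq_mul, ENNReal.toReal_mul, ENNReal.coe_toReal, NNReal.smul_def,
      smul_eq_mul, smul_eq_mul]
    field_simp
  rw [hfin]; rfl

lemma lap_eq {n : ℕ} (f : EuclideanSpace ℝ (Fin n) → ℝ) (hf : ContDiff ℝ 2 f)
    (y : EuclideanSpace ℝ (Fin n)) :
    lap f y = ∑ i, fderiv ℝ (fderiv ℝ f) y (EuclideanSpace.single i 1)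
      (EuclideanSpace.single i 1) := by
  have hdf : ContDiff ℝ 1 (fderiv ℝ f) := hf.fderiv_right (by norm_num)
  unfold lap
  refine Finset.sum_congr rfl fun i _ => ?_
  have := ((hdf.differentiable one_ne_zero y).hasFDerivAt).clm_apply
    (hasFDerivAt_const (EuclideanSpace.single i (1:ℝ)) y)
  rw [this.fderiv]
  simp

end EPD

open EPD

/-- Euler–Poisson–Darboux equation in Euclidean space.  For `n ≥ 2`
and `f : ℝⁿ → ℝ` of class `C²`, for every `x` and `r > 0` the spherical mean
`I_f(x, ·)` is twice differentiable at `r` and satisfies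
`I_f''(x,r) + ((n-1)/r) I_f'(x,r) = I_{Δf}(x,r)`. -/
theorem euler_poisson_darboux
    (n : ℕ) (hn : 2 ≤ n) (f : EuclideanSpace ℝ (Fin n) → ℝ)
    (hf : ContDiff ℝ 2 f)
    (x : EuclideanSpace ℝ (Fin n)) (r : ℝ) (hr : 0 < r) :
    DifferentiableAt ℝ (fun s => sphericalMean f x s) r ∧
    DifferentiableAt ℝ (deriv (fun s => sphericalMean f x s)) r ∧
    deriv (deriv (fun s => sphericalMean f x s)) r
      + ((n : ℝ) - 1) / r * deriv (fun s => sphericalMean f x s) r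
      = sphericalMean (fun y => lap f y) x r := by
  have hdf : ContDiff ℝ 1 (fderiv ℝ f) := hf.fderiv_right (by norm_num)
  have hK := isCompact_sphere (0 : EuclideanSpace ℝ (Fin n)) 1
  have hc1 : Continuous (fderiv ℝ f) := hdf.continuous
  have hc2 : Continuous (fderiv ℝ (fderiv ℝ f)) := hdf.continuous_fderiv one_ne_zero
  have hφ : ∀ (w : EuclideanSpace ℝ (Fin n)) (t : ℝ),
      HasDerivAt (fun s : ℝ => x + s • w) w t := fun w t => by
    simpa using ((hasDerivAt_id t).smul_const w).const_add x
  have hJ := hasDerivAt_integral_compact (nu n) _ hK (nu_ae n)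
    (fun s w => f (x + s • w)) (fun s w => fderiv ℝ f (x + s • w) w)
    (fun t => hf.continuous.comp (by fun_prop))
    ((hc1.comp (by fun_prop)).clm_apply continuous_snd)
    (fun t w => ((hf.differentiable two_ne_zero _).hasFDerivAt).comp_hasDerivAt t (hφ w t))
  have hJ1 := hasDerivAt_integral_compact (nu n) _ hK (nu_ae n)
    (fun s w => fderiv ℝ f (x + s • w) w)
    (fun s w => fderiv ℝ (fderiv ℝ f) (x + s • w) w w)
    (fun t => (hc1.comp (by fun_prop)).clm_apply continuous_id)
    (((hc2.comp (by fun_prop)).clm_apply continuous_snd).clm_apply continuous_snd)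
    (fun t w => by
      have h1 := ((hdf.differentiable one_ne_zero _).hasFDerivAt).comp_hasDerivAt t (hφ w t)
      simpa using h1.clm_apply (hasDerivAt_const t w))
  have hI : ∀ s, 0 < s → HasDerivAt (fun s => sphericalMean f x s)
      (∫ w, fderiv ℝ f (x + s • w) w ∂(nu n)) s := fun s hs =>
    (hJ s).congr_of_eventuallyEq (by
      filter_upwards [lt_mem_nhds hs] with t ht using mean_eq hn f x t ht)
  have hI1 : HasDerivAt (deriv (fun s => sphericalMean f x s))
      (∫ w, fderiv ℝ (fderiv ℝ f) (x + r • w) w w ∂(nu n)) r :=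
    (hJ1 r).congr_of_eventuallyEq (by
      filter_upwards [lt_mem_nhds hr] with t ht using (hI t ht).deriv)
  refine ⟨(hI r hr).differentiableAt, hI1.differentiableAt, ?_⟩
  rw [hI1.deriv, (hI r hr).deriv, mean_eq hn _ x r hr]
  have hint : ∀ F : EuclideanSpace ℝ (Fin n) → ℝ, Continuous F → Integrable F (nu n) :=
    integrable_compact (nu n) _ hK (nu_ae n)
  have hp : Continuous (fun w : EuclideanSpace ℝ (Fin n) => x + r • w) := by fun_prop
  have i1 := hint (fun w => fderiv ℝ f (x + r • w) w) ((hc1.comp hp).clm_apply continuous_id)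
  have i2 := hint (fun w => fderiv ℝ (fderiv ℝ f) (x + r • w) w w)
    (((hc2.comp hp).clm_apply continuous_id).clm_apply continuous_id)
  have i3 := hint (fun w => lap f (x + r • w)) (by
    simp_rw [lap_eq f hf]
    exact continuous_finsetSum _ fun i _ =>
      ((hc2.comp hp).clm_apply continuous_const).clm_apply continuous_const)
  have iij : ∀ i j : Fin n, Integrable (fun w =>
      r * fderiv ℝ (fderiv ℝ f) (x + r • w) (gen i j w) (gen i j w)
      + fderiv ℝ f (x + r • w) (gen i j (gen i j w))) (nu n) := fun i j => hint _ (by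
    have hg := (gen i j).continuous
    exact (continuous_const.mul (((hc2.comp hp).clm_apply hg).clm_apply hg)).add
      ((hc1.comp hp).clm_apply (hg.comp hg)))
  have hz : ∫ w, (∑ i, ∑ j, (r * fderiv ℝ (fderiv ℝ f) (x + r • w) (gen i j w) (gen i j w)
      + fderiv ℝ f (x + r • w) (gen i j (gen i j w)))) ∂(nu n) = 0 := by
    rw [integral_finsetSum _ fun i _ => integrable_finsetSum _ fun j _ => iij i j]
    refine Finset.sum_eq_zero fun i _ => ?_
    rw [integral_finsetSum _ fun j _ => iij i j]
    exact Finset.sum_eq_zero fun j _ =>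
      integral_rot_sq (nu n) _ hK (nu_ae n) (nu_inv n) (gen i j) (gen_skew i j) f hf x r
  have hz2 : ∫ w, 2 * (r * lap f (x + r • w) - r * fderiv ℝ (fderiv ℝ f) (x + r • w) w w
      - ((n : ℝ) - 1) * fderiv ℝ f (x + r • w) w) ∂(nu n) = 0 := by
    rw [← hz]
    refine integral_congr_ae ?_
    filter_upwards [nu_ae n] with w hw
    rw [algebra_id w (by simpa using hw), lap_eq f hf]
  have i4 : Integrable (fun w => r * lap f (x + r • w)
      - r * fderiv ℝ (fderiv ℝ f) (x + r • w) w w) (nu n) :=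
    (i3.const_mul r).sub (i2.const_mul r)
  rw [integral_const_mul, integral_sub i4
    (i1.const_mul _), integral_sub (i3.const_mul r) (i2.const_mul r), integral_const_mul,
    integral_const_mul, integral_const_mul] at hz2
  field_simp
  linarith
end

section
/- Differential inequality for spherical means of squared eigenfunctions: let n ≥ 2, λ ∈ ℝ, x ∈ ℝⁿ, R > 0, and let ψ be a C² function on the open ball B_R(x) ⊂ ℝⁿ satisfying Δψ = −λ²ψ there. Then the function I(r) = I_{ψ²}(x,r) (the spherical mean of ψ² over ∂B_r(x)) satisfies I''(r) + ((n−1)/r)·I'(r) + 2λ²·I(r) ≥ 0 for every r ∈ (0,R). -/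
open MeasureTheory Metric Set Filter

local notation "EE" n => EuclideanSpace ℝ (Fin n)

theorem sm_param_deriv {n : ℕ} (σ : Measure (EE n)) [IsFiniteMeasure σ] (K : Set (EE n))
    (hK : IsCompact K) (U : Set ℝ) (hU : IsOpen U) (t₀ : ℝ) (ht₀ : t₀ ∈ U)
    (F F' : ℝ → (EE n) → ℝ)
    (hF : ∀ t ∈ U, ContinuousOn (F t) K)
    (hd : ∀ t ∈ U, ∀ ω ∈ K, HasDerivAt (fun s => F s ω) (F' t ω) t)
    (hF' : ContinuousOn (fun p : ℝ × (EE n) => F' p.1 p.2) (U ×ˢ K)) :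
    HasDerivAt (fun t => ∫ ω in K, F t ω ∂σ) (∫ ω in K, F' t₀ ω ∂σ) t₀ := by
  obtain ⟨ε, hε, hball⟩ := Metric.isOpen_iff.1 hU t₀ ht₀
  have hsub : closedBall t₀ (ε / 2) ⊆ U :=
    (closedBall_subset_ball (by linarith)).trans hball
  have hc : IsCompact (closedBall t₀ (ε / 2) ×ˢ K) := (isCompact_closedBall _ _).prod hK
  obtain ⟨C, hC⟩ := hc.exists_bound_of_continuousOn
    (hF'.mono (Set.prod_mono hsub le_rfl))
  have hKm : MeasurableSet K := hK.isClosed.measurableSet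
  have hF't : ContinuousOn (F' t₀) K := by
    refine hF'.comp (f := fun ω => (t₀, ω)) (by fun_prop) ?_
    intro ω hω
    exact ⟨ht₀, hω⟩
  refine (hasDerivAt_integral_of_dominated_loc_of_deriv_le (bound := fun _ => C)
    (closedBall_mem_nhds t₀ (half_pos hε)) ?_ ?_ ?_ ?_ ?_ ?_).2
  · filter_upwards [hU.mem_nhds ht₀] with t ht
    exact (hF t ht).aestronglyMeasurable hKm
  · exact (hF t₀ ht₀).integrableOn_compact hK
  · exact hF't.aestronglyMeasurable hKm
  · refine (ae_restrict_iff' hKm).2 (Eventually.of_forall fun ω hω t ht => ?_)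
    exact hC (t, ω) ⟨ht, hω⟩
  · exact integrable_const C
  · refine (ae_restrict_iff' hKm).2 (Eventually.of_forall fun ω hω t ht => ?_)
    exact hd t (hsub ht) ω hω

theorem sm_rotate {n : ℕ} (d : ℝ) (e : (EE n) ≃ₗᵢ[ℝ] (EE n)) (G : (EE n) → ℝ) :
    ∫ ω in sphere (0 : EE n) 1, G (e ω) ∂(μH[d]) = ∫ ω in sphere (0 : EE n) 1, G ω ∂(μH[d]) := by
  have h := (e.toIsometryEquiv.measurePreserving_hausdorffMeasure d).setIntegral_preimage_emb
    (e.toHomeomorph.measurableEmbedding) G (sphere (0 : EE n) 1)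
  have hp : (⇑e.toIsometryEquiv ⁻¹' sphere (0 : EE n) 1) = sphere (0 : EE n) 1 := by
    ext ω; simp
  rw [hp] at h
  exact h

noncomputable def smRot {n : ℕ} (i j : Fin n) (t : ℝ) : (EE n) →ₗ[ℝ] (EE n) where
  toFun ω := ω + (Real.sin t * ω i - (1 - Real.cos t) * ω j) • EuclideanSpace.single j (1 : ℝ)
    + (-Real.sin t * ω j - (1 - Real.cos t) * ω i) • EuclideanSpace.single i (1 : ℝ)
  map_add' a b := by
    simp only [PiLp.add_apply]
    module
  map_smul' a b := by
    simp only [PiLp.smul_apply, smul_eq_mul, RingHom.id_apply]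
    module

theorem smRot_norm {n : ℕ} (i j : Fin n) (hij : i ≠ j) (t : ℝ) (ω : EE n) :
    ‖smRot i j t ω‖ = ‖ω‖ := by
  have h : ‖smRot i j t ω‖ ^ 2 = ‖ω‖ ^ 2 := by
    show ‖ω + _ + _‖ ^ 2 = _
    rw [norm_add_sq_real, norm_add_sq_real]
    simp only [inner_add_left, inner_smul_right, inner_smul_left, norm_smul,
      EuclideanSpace.inner_single_right, EuclideanSpace.norm_single]
    simp [hij]
    linear_combination (ω i ^ 2 + ω j ^ 2) * Real.sin_sq_add_cos_sq t
  exact (sq_eq_sq₀ (norm_nonneg _) (norm_nonneg _)).1 h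

noncomputable def smIso {n : ℕ} (i j : Fin n) (hij : i ≠ j) (t : ℝ) : (EE n) ≃ₗᵢ[ℝ] (EE n) :=
  LinearIsometry.toLinearIsometryEquiv ⟨smRot i j t, smRot_norm i j hij t⟩ rfl

theorem smIso_apply {n : ℕ} (i j : Fin n) (hij : i ≠ j) (t : ℝ) (ω : EE n) :
    smIso i j hij t ω =
    ω + (Real.sin t * ω i - (1 - Real.cos t) * ω j) • EuclideanSpace.single j (1 : ℝ)
    + (-Real.sin t * ω j - (1 - Real.cos t) * ω i) • EuclideanSpace.single i (1 : ℝ) := rfl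

noncomputable def smJ {n : ℕ} (i j : Fin n) (ω : EE n) : EE n :=
  ω i • EuclideanSpace.single j (1 : ℝ) - ω j • EuclideanSpace.single i (1 : ℝ)

theorem sm_skew {n : ℕ} (d : ℝ) [IsFiniteMeasure ((μH[d]).restrict (sphere (0 : EE n) 1))]
    (i j : Fin n) (G : (EE n) → ℝ) (U : Set (EE n)) (hU : IsOpen U)
    (hSU : sphere (0 : EE n) 1 ⊆ U) (hG : ContDiffOn ℝ 1 G U) :
    ∫ ω in sphere (0 : EE n) 1, fderiv ℝ G ω (smJ i j ω) ∂(μH[d]) = 0 := by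
  by_cases hij : i = j
  · subst hij; simp [smJ]
  have hS : IsCompact (sphere (0 : EE n) 1) := isCompact_sphere _ _
  have hmem : ∀ t, ∀ ω ∈ sphere (0 : EE n) 1, smIso i j hij t ω ∈ U := by
    intro t ω hω
    apply hSU
    simpa using hω
  have hcont : Continuous (fun p : ℝ × (EE n) => smIso i j hij p.1 p.2) := by
    simp only [smIso_apply]
    fun_prop
  have key := sm_param_deriv ((μH[d]).restrict (sphere (0 : EE n) 1)) (sphere (0 : EE n) 1) hS
    univ isOpen_univ 0 (mem_univ _) (fun t ω => G (smIso i j hij t ω))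
    (fun t ω => fderiv ℝ G (smIso i j hij t ω)
      ((Real.cos t * ω i - Real.sin t * ω j) • EuclideanSpace.single j (1 : ℝ)
        + (-Real.cos t * ω j - Real.sin t * ω i) • EuclideanSpace.single i (1 : ℝ)))
    ?_ ?_ ?_
  · rw [Measure.restrict_restrict hS.isClosed.measurableSet, inter_self] at key
    simp only [sm_rotate d _ G] at key
    have h0 := key.unique (hasDerivAt_const _ _)
    rw [← h0]
    congr 1
    ext ω
    simp only [smIso_apply, smJ]
    simp [sub_eq_add_neg]
  · intro t _
    exact hG.continuousOn.comp (smIso i j hij t).continuous.continuousOn (hmem t)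
  · intro t _ ω hω
    have h1 : HasFDerivAt G (fderiv ℝ G (smIso i j hij t ω)) (smIso i j hij t ω) :=
      ((hG.differentiableOn one_ne_zero).differentiableAt (hU.mem_nhds (hmem t ω hω))).hasFDerivAt
    refine h1.comp_hasDerivAt t ?_
    simp only [smIso_apply]
    have hs := Real.hasDerivAt_sin t
    have hc := Real.hasDerivAt_cos t
    have h2 : HasDerivAt (fun t => Real.sin t * ω i - (1 - Real.cos t) * ω j)
      (Real.cos t * ω i - Real.sin t * ω j) t := by
      exact ((hs.mul_const (ω i)).sub ((hc.const_sub 1).mul_const (ω j))).congr_deriv (by ring)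
    have h3 : HasDerivAt (fun t => -Real.sin t * ω j - (1 - Real.cos t) * ω i)
      (-Real.cos t * ω j - Real.sin t * ω i) t := by
      exact ((hs.neg.mul_const (ω j)).sub ((hc.const_sub 1).mul_const (ω i))).congr_deriv (by ring)
    exact ((h2.smul_const _).const_add ω).add (h3.smul_const _)
  · have h1 : ContinuousOn (fderiv ℝ G) U := hG.continuousOn_fderiv_of_isOpen hU le_rfl
    refine ContinuousOn.clm_apply (h1.comp hcont.continuousOn fun p hp => hmem _ _ hp.2) ?_
    fun_prop

theorem sm_hess_sum {n : ℕ} (H : (EE n) →L[ℝ] (EE n) →L[ℝ] ℝ) (ω : EE n) (hω : ‖ω‖ = 1) :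
    ∑ i, ∑ j, H (smJ i j ω) (smJ i j ω) =
      2 * (∑ i, H (EuclideanSpace.single i 1) (EuclideanSpace.single i 1)) - 2 * H ω ω := by
  have hexp : ω = ∑ i, ω i • EuclideanSpace.single i (1 : ℝ) := by
    ext k; simp [Finset.sum_apply, Pi.single_apply]
  have hn : ∑ i, ω i * ω i = 1 := by
    have := EuclideanSpace.real_norm_sq_eq ω
    rw [hω] at this
    simp only [pow_two] at this
    linarith
  have hH : H ω ω = ∑ i, ∑ j, ω i * ω j * H (EuclideanSpace.single i 1) (EuclideanSpace.single j 1) := by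
    conv_lhs => rw [hexp]
    simp only [map_sum, map_smul, _root_.sum_apply, _root_.smul_apply, smul_eq_mul]
    rw [Finset.sum_comm]
    refine Finset.sum_congr rfl fun i _ => ?_
    rw [Finset.mul_sum]
    exact Finset.sum_congr rfl fun j _ => by ring
  have hterm : ∀ i j, H (smJ i j ω) (smJ i j ω) =
      (ω i * ω i) * H (EuclideanSpace.single j 1) (EuclideanSpace.single j 1)
      + (ω j * ω j) * H (EuclideanSpace.single i 1) (EuclideanSpace.single i 1)
      - ω i * ω j * H (EuclideanSpace.single i 1) (EuclideanSpace.single j 1)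
      - ω j * ω i * H (EuclideanSpace.single j 1) (EuclideanSpace.single i 1) := by
    intro i j
    simp only [smJ, map_sub, map_smul, _root_.sub_apply, _root_.smul_apply, smul_eq_mul]
    ring
  simp only [hterm, Finset.sum_sub_distrib, Finset.sum_add_distrib]
  have e1 : ∑ i, ∑ j, (ω i * ω i) * H (EuclideanSpace.single j 1) (EuclideanSpace.single j 1)
      = ∑ j, H (EuclideanSpace.single j 1) (EuclideanSpace.single j 1) := by
    simp only [← Finset.mul_sum, ← Finset.sum_mul, hn, one_mul]
  have e2 : ∑ i, ∑ j, (ω j * ω j) * H (EuclideanSpace.single i 1) (EuclideanSpace.single i 1)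
      = ∑ j, H (EuclideanSpace.single j 1) (EuclideanSpace.single j 1) := by
    simp only [← Finset.sum_mul, hn, one_mul]
  have e3 : ∑ i, ∑ j, ω j * ω i * H (EuclideanSpace.single j 1) (EuclideanSpace.single i 1) = H ω ω := by
    rw [hH, Finset.sum_comm]
  rw [e1, e2, e3, ← hH]
  ring

theorem sm_JJ_sum {n : ℕ} (ω : EE n) :
    ∑ i, ∑ j, smJ i j (smJ i j ω) = (-(2 * ((n : ℝ) - 1))) • ω := by
  ext k
  have h : ∀ i j : Fin n, (smJ i j (smJ i j ω)) k =
      (if i = j then 2 * (if k = i then ω i else 0) else 0)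
       - (if k = j then ω j else 0) - (if k = i then ω i else 0) := by
    intro i j
    by_cases hij : i = j
    · subst hij; simp [smJ]; split_ifs <;> ring
    · have hji : ¬ j = i := fun h => hij h.symm
      simp [smJ, hij, hji]
  simp [h, Finset.sum_sub_distrib, Finset.sum_ite_eq]
  ring

noncomputable def smJL {n : ℕ} (i j : Fin n) : (EE n) →L[ℝ] (EE n) :=
  (EuclideanSpace.proj i : (EE n) →L[ℝ] ℝ).smulRight (EuclideanSpace.single j (1 : ℝ))
    - (EuclideanSpace.proj j : (EE n) →L[ℝ] ℝ).smulRight (EuclideanSpace.single i (1 : ℝ))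

theorem smJL_apply {n : ℕ} (i j : Fin n) (ω : EE n) : smJL i j ω = smJ i j ω := rfl

theorem sm_mem {n : ℕ} {x ω : EE n} {R s : ℝ} (hs : s ∈ Ioo 0 R)
    (hω : ω ∈ sphere (0 : EE n) 1) : x + s • ω ∈ ball x R := by
  have : ‖ω‖ = 1 := by simpa using hω
  simp [norm_smul, this, abs_of_pos hs.1, hs.2]

theorem sm_fderiv_contDiffOn {n : ℕ} {u : (EE n) → ℝ} {x : EE n} {R : ℝ}
    (hu : ContDiffOn ℝ 2 u (ball x R)) : ContDiffOn ℝ 1 (fderiv ℝ u) (ball x R) :=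
  hu.fderiv_of_isOpen isOpen_ball (by norm_num)

theorem sm_lap_eq {n : ℕ} {u : (EE n) → ℝ} {x : EE n} {R : ℝ}
    (hu : ContDiffOn ℝ 2 u (ball x R)) {y : EE n} (hy : y ∈ ball x R) :
    lap u y = ∑ i, fderiv ℝ (fderiv ℝ u) y (EuclideanSpace.single i 1)
      (EuclideanSpace.single i 1) := by
  unfold lap
  refine Finset.sum_congr rfl fun i _ => ?_
  have h1 : HasFDerivAt (fderiv ℝ u) (fderiv ℝ (fderiv ℝ u) y) y :=
    (((sm_fderiv_contDiffOn hu).differentiableOn one_ne_zero).differentiableAt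
      (isOpen_ball.mem_nhds hy)).hasFDerivAt
  have h2 := h1.clm_apply (hasFDerivAt_const (EuclideanSpace.single i (1 : ℝ)) y)
  rw [h2.fderiv]
  simp

theorem sm_deriv1 {n : ℕ} (σ : Measure (EE n)) [IsFiniteMeasure σ] {u : (EE n) → ℝ} {x : EE n} {R : ℝ}
    (hu : ContDiffOn ℝ 2 u (ball x R)) {r : ℝ} (hr : r ∈ Ioo 0 R) :
    HasDerivAt (fun s => ∫ ω in sphere (0 : EE n) 1, u (x + s • ω) ∂σ)
      (∫ ω in sphere (0 : EE n) 1, fderiv ℝ u (x + r • ω) ω ∂σ) r := by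
  refine sm_param_deriv σ _ (isCompact_sphere _ _) (Ioo 0 R) isOpen_Ioo r hr
    (fun s ω => u (x + s • ω)) (fun s ω => fderiv ℝ u (x + s • ω) ω) ?_ ?_ ?_
  · intro s hs
    exact hu.continuousOn.comp (by fun_prop) fun ω hω => sm_mem hs hω
  · intro s hs ω hω
    have h1 : HasFDerivAt u (fderiv ℝ u (x + s • ω)) (x + s • ω) :=
      ((hu.differentiableOn two_ne_zero).differentiableAt
        (isOpen_ball.mem_nhds (sm_mem hs hω))).hasFDerivAt
    have h2 : HasDerivAt (fun s : ℝ => x + s • ω) ω s := by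
      simpa using ((hasDerivAt_id s).smul_const ω).const_add x
    exact h1.comp_hasDerivAt s h2
  · refine ContinuousOn.clm_apply ((sm_fderiv_contDiffOn hu).continuousOn.comp
      (f := fun p : ℝ × (EE n) => x + p.1 • p.2) (by fun_prop) fun p hp => sm_mem hp.1 hp.2) ?_
    fun_prop

theorem sm_aux1 {E : Type*} [NormedAddCommGroup E] [NormedSpace ℝ E] {g : E → E →L[ℝ] ℝ}
    {g' : E →L[ℝ] E →L[ℝ] ℝ} {x ω : E} {s : ℝ} (h : HasFDerivAt g g' (x + s • ω)) :
    HasDerivAt (fun s : ℝ => g (x + s • ω) ω) (g' ω ω) s := by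
  have h2 : HasDerivAt (fun s : ℝ => x + s • ω) ω s := by
    simpa using ((hasDerivAt_id s).smul_const ω).const_add x
  have h3 : HasDerivAt (fun s : ℝ => g (x + s • ω)) (g' ω) s := h.comp_hasDerivAt s h2
  simpa using h3.clm_apply (hasDerivAt_const s ω)

theorem sm_aux2 {E : Type*} [NormedAddCommGroup E] [NormedSpace ℝ E] {g : E → E →L[ℝ] ℝ}
    {g' : E →L[ℝ] E →L[ℝ] ℝ} {x ω : E} {r : ℝ} (L : E →L[ℝ] E)
    (h : HasFDerivAt g g' (x + r • ω)) (v : E) :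
    fderiv ℝ (fun ω => g (x + r • ω) (L ω)) ω v = r * g' v (L ω) + g (x + r • ω) (L v) := by
  have h2 : HasFDerivAt (fun ω : E => x + r • ω) (r • ContinuousLinearMap.id ℝ E) ω :=
    ((hasFDerivAt_id ω).const_smul r).const_add x
  have h3 : HasFDerivAt (fun ω : E => g (x + r • ω)) (g'.comp (r • ContinuousLinearMap.id ℝ E)) ω :=
    h.comp ω h2
  have h4 := h3.clm_apply L.hasFDerivAt
  rw [h4.fderiv]
  simp
  ring

theorem sm_deriv2 {n : ℕ} (σ : Measure (EE n)) [IsFiniteMeasure σ] {u : (EE n) → ℝ} {x : EE n} {R : ℝ}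
    (hu : ContDiffOn ℝ 2 u (ball x R)) {r : ℝ} (hr : r ∈ Ioo 0 R) :
    HasDerivAt (fun s => ∫ ω in sphere (0 : EE n) 1, fderiv ℝ u (x + s • ω) ω ∂σ)
      (∫ ω in sphere (0 : EE n) 1, fderiv ℝ (fderiv ℝ u) (x + r • ω) ω ω ∂σ) r := by
  have hu1 := sm_fderiv_contDiffOn hu
  have hu2 : ContinuousOn (fderiv ℝ (fderiv ℝ u)) (ball x R) :=
    hu1.continuousOn_fderiv_of_isOpen isOpen_ball le_rfl
  refine sm_param_deriv σ _ (isCompact_sphere _ _) (Ioo 0 R) isOpen_Ioo r hr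
    (fun s ω => fderiv ℝ u (x + s • ω) ω)
    (fun s ω => fderiv ℝ (fderiv ℝ u) (x + s • ω) ω ω) ?_ ?_ ?_
  · intro s hs
    exact (hu1.continuousOn.comp (f := fun ω => x + s • ω) (by fun_prop)
      fun ω hω => sm_mem hs hω).clm_apply continuousOn_id
  · intro s hs ω hω
    have h1 : HasFDerivAt (fderiv ℝ u) (fderiv ℝ (fderiv ℝ u) (x + s • ω)) (x + s • ω) :=
      ((hu1.differentiableOn one_ne_zero).differentiableAt
        (isOpen_ball.mem_nhds (sm_mem hs hω))).hasFDerivAt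
    exact sm_aux1 h1
  · refine ContinuousOn.clm_apply (ContinuousOn.clm_apply (hu2.comp
      (f := fun p : ℝ × (EE n) => x + p.1 • p.2) (by fun_prop) fun p hp => sm_mem hp.1 hp.2) ?_) ?_
    · fun_prop
    · fun_prop

theorem sm_identity {n : ℕ} (d : ℝ) [IsFiniteMeasure ((μH[d]).restrict (sphere (0 : EE n) 1))]
    {u : (EE n) → ℝ} {x : EE n} {R : ℝ}
    (hu : ContDiffOn ℝ 2 u (ball x R)) {r : ℝ} (hr : r ∈ Ioo 0 R) :
    (∫ ω in sphere (0 : EE n) 1, fderiv ℝ (fderiv ℝ u) (x + r • ω) ω ω ∂(μH[d]))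
      + ((n : ℝ) - 1) / r * (∫ ω in sphere (0 : EE n) 1, fderiv ℝ u (x + r • ω) ω ∂(μH[d]))
      = ∫ ω in sphere (0 : EE n) 1, lap u (x + r • ω) ∂(μH[d]) := by
  have hu1 := sm_fderiv_contDiffOn hu
  have hu2 : ContinuousOn (fderiv ℝ (fderiv ℝ u)) (ball x R) :=
    hu1.continuousOn_fderiv_of_isOpen isOpen_ball le_rfl
  have hS : IsCompact (sphere (0 : EE n) 1) := isCompact_sphere _ _
  have hSm : MeasurableSet (sphere (0 : EE n) 1) := hS.isClosed.measurableSet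
  have hint : ∀ f : (EE n) → ℝ, ContinuousOn f (sphere (0 : EE n) 1) →
      IntegrableOn f (sphere (0 : EE n) 1) (μH[d]) := by
    intro f hf
    have := hf.integrableOn_compact (μ := (μH[d]).restrict (sphere (0 : EE n) 1)) hS
    rwa [IntegrableOn, Measure.restrict_restrict hSm, inter_self] at this
  have c1 : ContinuousOn (fun ω => fderiv ℝ u (x + r • ω)) (sphere (0 : EE n) 1) :=
    hu1.continuousOn.comp (f := fun ω => x + r • ω) (by fun_prop) fun ω hω => sm_mem hr hω
  have c2 : ContinuousOn (fun ω => fderiv ℝ (fderiv ℝ u) (x + r • ω)) (sphere (0 : EE n) 1) :=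
    hu2.comp (f := fun ω => x + r • ω) (by fun_prop) fun ω hω => sm_mem hr hω
  have hij : ∀ i j : Fin n, ∫ ω in sphere (0 : EE n) 1,
      (r * fderiv ℝ (fderiv ℝ u) (x + r • ω) (smJL i j ω) (smJL i j ω)
        + fderiv ℝ u (x + r • ω) (smJL i j (smJL i j ω))) ∂(μH[d]) = 0 := by
    intro i j
    have hpre : IsOpen ((fun ω : EE n => x + r • ω) ⁻¹' ball x R) :=
      isOpen_ball.preimage (by fun_prop)
    have hcd : ContDiffOn ℝ 1 (fun ω => fderiv ℝ u (x + r • ω) (smJL i j ω))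
        ((fun ω : EE n => x + r • ω) ⁻¹' ball x R) := by
      have hg : ContDiffOn ℝ 1 (fun ω => fderiv ℝ u (x + r • ω))
          ((fun ω : EE n => x + r • ω) ⁻¹' ball x R) :=
        hu1.comp (g := fderiv ℝ u) (f := fun ω => x + r • ω) (by fun_prop) fun ω hω => hω
      exact hg.clm_apply (smJL i j).contDiff.contDiffOn
    have hsub : sphere (0 : EE n) 1 ⊆ (fun ω : EE n => x + r • ω) ⁻¹' ball x R := by
      intro ω hω
      rw [mem_preimage]
      exact sm_mem hr hω
    have hsk := sm_skew d i j _ _ hpre hsub hcd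
    refine Eq.trans (setIntegral_congr_fun hSm ?_) hsk
    intro ω hω
    have h1 : HasFDerivAt (fderiv ℝ u) (fderiv ℝ (fderiv ℝ u) (x + r • ω)) (x + r • ω) :=
      ((hu1.differentiableOn one_ne_zero).differentiableAt
        (isOpen_ball.mem_nhds (sm_mem hr hω))).hasFDerivAt
    have h2 := sm_aux2 (smJL i j) h1 (smJ i j ω)
    beta_reduce
    rw [h2, smJL_apply]
  have hcij : ∀ i j : Fin n, ContinuousOn (fun ω => 
      (r * fderiv ℝ (fderiv ℝ u) (x + r • ω) (smJL i j ω) (smJL i j ω)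
        + fderiv ℝ u (x + r • ω) (smJL i j (smJL i j ω)))) (sphere (0 : EE n) 1) := by
    intro i j
    exact (continuousOn_const.mul ((c2.clm_apply (by fun_prop)).clm_apply (by fun_prop))).add
      (c1.clm_apply (by fun_prop))
  have hsum : ∫ ω in sphere (0 : EE n) 1, (∑ i, ∑ j, 
      (r * fderiv ℝ (fderiv ℝ u) (x + r • ω) (smJL i j ω) (smJL i j ω)
        + fderiv ℝ u (x + r • ω) (smJL i j (smJL i j ω)))) ∂(μH[d]) = 0 := by
    rw [integral_finsetSum]
    · refine Finset.sum_eq_zero fun i _ => ?_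
      rw [integral_finsetSum]
      · exact Finset.sum_eq_zero fun j _ => hij i j
      · exact fun j _ => hint _ (hcij i j)
    · exact fun i _ => integrable_finsetSum _ fun j _ => hint _ (hcij i j)
  have hpt : ∀ ω ∈ sphere (0 : EE n) 1, (∑ i, ∑ j, 
      (r * fderiv ℝ (fderiv ℝ u) (x + r • ω) (smJL i j ω) (smJL i j ω)
        + fderiv ℝ u (x + r • ω) (smJL i j (smJL i j ω)))) =
      2 * r * (lap u (x + r • ω) - (fderiv ℝ (fderiv ℝ u) (x + r • ω) ω ω
        + ((n : ℝ) - 1) / r * fderiv ℝ u (x + r • ω) ω)) := by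
    intro ω hω
    have hr0 : r ≠ 0 := hr.1.ne'
    simp only [Finset.sum_add_distrib, ← Finset.mul_sum, ← map_sum, smJL_apply]
    rw [sm_hess_sum _ ω (by simpa using hω), sm_JJ_sum, sm_lap_eq hu (sm_mem hr hω), map_smul,
      smul_eq_mul]
    field_simp
    ring
  have i1 := hint _ (c1.clm_apply continuousOn_id)
  have i2 := hint _ ((c2.clm_apply continuousOn_id).clm_apply continuousOn_id)
  have i3 : IntegrableOn (fun ω => lap u (x + r • ω)) (sphere (0 : EE n) 1) (μH[d]) := by
    refine (hint (fun ω => ∑ i, fderiv ℝ (fderiv ℝ u) (x + r • ω) (EuclideanSpace.single i 1)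
      (EuclideanSpace.single i 1)) ?_).congr_fun
      (fun ω hω => (sm_lap_eq hu (sm_mem hr hω)).symm) hSm
    exact continuousOn_finsetSum _ fun i _ =>
      (c2.clm_apply continuousOn_const).clm_apply continuousOn_const
  rw [setIntegral_congr_fun hSm hpt, integral_const_mul] at hsum
  have h0 := (mul_eq_zero.1 hsum).resolve_left (by have := hr.1; positivity)
  simp only [id] at i1 i2
  have i1' : IntegrableOn (fun ω => ((n : ℝ) - 1) / r * fderiv ℝ u (x + r • ω) ω)
    (sphere (0 : EE n) 1) (μH[d]) := i1.const_mul _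
  have i4 : IntegrableOn (fun ω => fderiv ℝ (fderiv ℝ u) (x + r • ω) ω ω
        + ((n : ℝ) - 1) / r * fderiv ℝ u (x + r • ω) ω) (sphere (0 : EE n) 1) (μH[d]) := i2.add i1'
  rw [integral_sub i3 i4, integral_add i2 i1', integral_const_mul] at h0
  linarith

theorem sm_mean_eq {n : ℕ} (hn : 2 ≤ n) (f : (EE n) → ℝ) (x : EE n) {r : ℝ} (hr : 0 < r) :
    sphericalMean f x r = ((μH[(n : ℝ) - 1]).real (sphere (0 : EE n) 1))⁻¹ *
      ∫ ω in sphere (0 : EE n) 1, f (x + r • ω) ∂(μH[(n : ℝ) - 1]) := by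
  have hd : (0 : ℝ) ≤ (n : ℝ) - 1 := by
    have : (2 : ℝ) ≤ n := by exact_mod_cast hn
    linarith
  unfold sphericalMean
  generalize (n : ℝ) - 1 = d at hd ⊢
  let e : (EE n) ≃ₜ (EE n) := (Homeomorph.smulOfNeZero r hr.ne').trans (Homeomorph.addLeft x)
  have he : ∀ ω, e ω = x + r • ω := fun ω => rfl
  have hmap : Measure.map e (μH[d]) = (‖r‖₊⁻¹ ^ d : NNReal) • (μH[d] : Measure (EE n)) := by
    have h1 : Measure.map (fun ω : EE n => r • ω) (μH[d])
        = (‖r‖₊⁻¹ ^ d : NNReal) • (μH[d] : Measure (EE n)) := by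
      have := map_homothety_hausdorffMeasure (P := EE n) (𝕜 := ℝ) hd (0 : EE n) hr.ne'
      rw [← this]
      congr 1
      ext ω : 1
      simp [AffineMap.homothety_apply]
    have h2 : (e : (EE n) → (EE n)) = (fun y => x + y) ∘ (fun ω => r • ω) := rfl
    rw [h2, ← Measure.map_map (by fun_prop) (by fun_prop), h1, Measure.map_smul]
    congr 1
    exact ((IsometryEquiv.addLeft x).measurePreserving_hausdorffMeasure d).map_eq
  have hpre : e ⁻¹' sphere x r = sphere (0 : EE n) 1 := by
    ext ω
    simp [he, norm_smul, abs_of_pos hr, hr.ne']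
  have hSm : MeasurableSet (sphere x r) := isClosed_sphere.measurableSet
  have hc : ((‖r‖₊⁻¹ ^ d : NNReal) : ℝ) ≠ 0 := by
    have : 0 < ‖r‖₊⁻¹ := by simp [hr.ne']
    exact_mod_cast (NNReal.rpow_pos this).ne'
  have hint := e.measurableEmbedding.setIntegral_map (μ := μH[d]) f (sphere x r)
  rw [hpre, hmap, Measure.restrict_smul, integral_smul_nnreal_measure] at hint
  have hmeas : (μH[d]).real (sphere (0 : EE n) 1)
      = ((‖r‖₊⁻¹ ^ d : NNReal) : ℝ) * (μH[d]).real (sphere x r) := by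
    have := congrArg (fun ν : Measure (EE n) => ν.real (sphere x r)) hmap
    simp only [measureReal_def, Measure.map_apply e.continuous.measurable hSm, hpre] at this ⊢
    rw [this]
    rw [Measure.smul_apply, ENNReal.smul_def, smul_eq_mul, ENNReal.toReal_mul, ENNReal.coe_toReal]
  rw [setAverage_eq, hmeas, ← (show _ = ∫ ω in sphere (0 : EE n) 1, f (x + r • ω) ∂(μH[d]) from hint)]
  rw [NNReal.smul_def, smul_eq_mul, smul_eq_mul]
  generalize ((‖r‖₊⁻¹ ^ d : NNReal) : ℝ) = k at hc ⊢
  rw [mul_inv, mul_assoc, mul_left_comm, inv_mul_cancel_left₀ hc]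

theorem sm_lap_sq {n : ℕ} {u : (EE n) → ℝ} {x : EE n} {R : ℝ}
    (hu : ContDiffOn ℝ 2 u (ball x R)) {y : EE n} (hy : y ∈ ball x R) :
    2 * u y * lap u y ≤ lap (fun z => u z ^ 2) y := by
  unfold lap
  rw [Finset.mul_sum]
  refine Finset.sum_le_sum fun i _ => ?_
  set e : EE n := EuclideanSpace.single i (1 : ℝ)
  have hd : ∀ z ∈ ball x R, HasFDerivAt u (fderiv ℝ u z) z := fun z hz =>
    ((hu.differentiableOn two_ne_zero).differentiableAt (isOpen_ball.mem_nhds hz)).hasFDerivAt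
  have h1 : HasFDerivAt (fderiv ℝ u) (fderiv ℝ (fderiv ℝ u) y) y :=
    (((sm_fderiv_contDiffOn hu).differentiableOn one_ne_zero).differentiableAt
      (isOpen_ball.mem_nhds hy)).hasFDerivAt
  have h2 : DifferentiableAt ℝ (fun z => fderiv ℝ u z e) y :=
    (h1.clm_apply (hasFDerivAt_const e y)).differentiableAt
  have hev : (fun z => fderiv ℝ (fun w => u w ^ 2) z e) =ᶠ[nhds y]
      (fun z => 2 * (u z * fderiv ℝ u z e)) := by
    filter_upwards [isOpen_ball.mem_nhds hy] with z hz
    rw [((hd z hz).pow 2).fderiv]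
    simp
    ring
  have h3 : HasFDerivAt (fun z => 2 * (u z * fderiv ℝ u z e)) _ y :=
    ((hd y hy).mul h2.hasFDerivAt).const_mul 2
  rw [hev.fderiv_eq, h3.fderiv]
  simp
  nlinarith [mul_self_nonneg (fderiv ℝ u y e)]

/-- Differential inequality for spherical means of squared
eigenfunctions.  For `n ≥ 2`, `λ ∈ ℝ`, `x ∈ ℝⁿ`, `R > 0`, and `ψ` of class `C²`
on `B_R(x)` with `Δψ = -λ²ψ` there, the function `I(r) = I_{ψ²}(x,r)` satisfies
`I''(r) + ((n-1)/r) I'(r) + 2λ² I(r) ≥ 0` for every `r ∈ (0,R)`. -/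
theorem spherical_means_differential_inequality
    (n : ℕ) (hn : 2 ≤ n) (lam : ℝ) (x : EuclideanSpace ℝ (Fin n)) (R : ℝ) (hR : 0 < R)
    (ψ : EuclideanSpace ℝ (Fin n) → ℝ)
    (hψ : ContDiffOn ℝ 2 ψ (ball x R))
    (heig : ∀ y ∈ ball x R, lap ψ y = -lam ^ 2 * ψ y) :
    ∀ r ∈ Ioo (0 : ℝ) R,
      deriv (deriv (fun s => sphericalMean (fun y => ψ y ^ 2) x s)) r
        + ((n : ℝ) - 1) / r * deriv (fun s => sphericalMean (fun y => ψ y ^ 2) x s) r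
        + 2 * lam ^ 2 * sphericalMean (fun y => ψ y ^ 2) x r ≥ 0 := by
  intro r hr
  set d := (n : ℝ) - 1 with hd
  set c : ℝ := ((μH[d]).real (sphere (0 : EuclideanSpace ℝ (Fin n)) 1))⁻¹ with hc
  have hc0 : 0 ≤ c := by positivity
  have hu : ContDiffOn ℝ 2 (fun y => ψ y ^ 2) (ball x R) := hψ.pow 2
  set u : EuclideanSpace ℝ (Fin n) → ℝ := fun y => ψ y ^ 2 with hudef
  have hmean : ∀ s ∈ Ioo (0 : ℝ) R, sphericalMean u x s =
      c * ∫ ω in sphere (0 : EuclideanSpace ℝ (Fin n)) 1, u (x + s • ω) ∂(μH[d]) :=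
    fun s hs => sm_mean_eq hn u x hs.1
  by_cases hfin : μH[d] (sphere (0 : EuclideanSpace ℝ (Fin n)) 1) = ⊤
  · have hcz : c = 0 := by simp [hc, measureReal_def, hfin]
    have hz : ∀ s ∈ Ioo (0 : ℝ) R, (fun s => sphericalMean u x s) =ᶠ[nhds s] fun _ => 0 := by
      intro s hs
      filter_upwards [isOpen_Ioo.mem_nhds hs] with t ht
      rw [hmean t ht, hcz, zero_mul]
    have hz1 : deriv (fun s => sphericalMean u x s) =ᶠ[nhds r] fun _ => 0 := by
      filter_upwards [isOpen_Ioo.mem_nhds hr] with t ht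
      rw [(hz t ht).deriv_eq]
      simp
    rw [hz1.deriv_eq, (hz r hr).deriv_eq, hmean r hr, hcz]
    simp
  · have : IsFiniteMeasure ((μH[d]).restrict (sphere (0 : EuclideanSpace ℝ (Fin n)) 1)) :=
      ⟨by simpa using lt_top_iff_ne_top.2 hfin⟩
    have hS : IsCompact (sphere (0 : EuclideanSpace ℝ (Fin n)) 1) := isCompact_sphere _ _
    have hSm : MeasurableSet (sphere (0 : EuclideanSpace ℝ (Fin n)) 1) := hS.isClosed.measurableSet
    have hd1 : ∀ s ∈ Ioo (0 : ℝ) R, HasDerivAt (fun s => sphericalMean u x s)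
        (c * ∫ ω in sphere (0 : EuclideanSpace ℝ (Fin n)) 1,
          fderiv ℝ u (x + s • ω) ω ∂(μH[d])) s := by
      intro s hs
      have h := sm_deriv1 ((μH[d]).restrict (sphere (0 : EuclideanSpace ℝ (Fin n)) 1)) hu hs
      rw [Measure.restrict_restrict hSm, inter_self] at h
      refine (h.const_mul c).congr_of_eventuallyEq ?_
      filter_upwards [isOpen_Ioo.mem_nhds hs] with t ht
      exact hmean t ht
    have hd2 : HasDerivAt (deriv (fun s => sphericalMean u x s))
        (c * ∫ ω in sphere (0 : EuclideanSpace ℝ (Fin n)) 1,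
          fderiv ℝ (fderiv ℝ u) (x + r • ω) ω ω ∂(μH[d])) r := by
      have h := sm_deriv2 ((μH[d]).restrict (sphere (0 : EuclideanSpace ℝ (Fin n)) 1)) hu hr
      rw [Measure.restrict_restrict hSm, inter_self] at h
      refine (h.const_mul c).congr_of_eventuallyEq ?_
      filter_upwards [isOpen_Ioo.mem_nhds hr] with t ht
      exact (hd1 t ht).deriv
    rw [hd2.deriv, (hd1 r hr).deriv, hmean r hr]
    have hid := sm_identity d hu hr
    have hle : ∫ ω in sphere (0 : EuclideanSpace ℝ (Fin n)) 1,
        (-(2 * lam ^ 2) * u (x + r • ω)) ∂(μH[d]) ≤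
        ∫ ω in sphere (0 : EuclideanSpace ℝ (Fin n)) 1, lap u (x + r • ω) ∂(μH[d]) := by
      have hi : ∀ f : EuclideanSpace ℝ (Fin n) → ℝ,
          ContinuousOn f (sphere (0 : EuclideanSpace ℝ (Fin n)) 1) →
          IntegrableOn f (sphere (0 : EuclideanSpace ℝ (Fin n)) 1) (μH[d]) := by
        intro f hf
        have := hf.integrableOn_compact
          (μ := (μH[d]).restrict (sphere (0 : EuclideanSpace ℝ (Fin n)) 1)) hS
        rwa [IntegrableOn, Measure.restrict_restrict hSm, inter_self] at this
      refine setIntegral_mono_on ?_ ?_ hSm ?_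
      · exact hi _ (continuousOn_const.mul (hu.continuousOn.comp
          (f := fun ω => x + r • ω) (by fun_prop) fun ω hω => sm_mem hr hω))
      · have c2 : ContinuousOn (fun ω => fderiv ℝ (fderiv ℝ u) (x + r • ω))
            (sphere (0 : EuclideanSpace ℝ (Fin n)) 1) :=
          ((sm_fderiv_contDiffOn hu).continuousOn_fderiv_of_isOpen isOpen_ball le_rfl).comp
            (f := fun ω => x + r • ω) (by fun_prop) fun ω hω => sm_mem hr hω
        refine (hi (fun ω => ∑ i, fderiv ℝ (fderiv ℝ u) (x + r • ω) (EuclideanSpace.single i 1)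
          (EuclideanSpace.single i 1)) ?_).congr_fun
          (fun ω hω => (sm_lap_eq hu (sm_mem hr hω)).symm) hSm
        exact continuousOn_finsetSum _ fun i _ =>
          (c2.clm_apply continuousOn_const).clm_apply continuousOn_const
      · intro ω hω
        have h1 := sm_lap_sq hψ (sm_mem hr hω)
        rw [heig _ (sm_mem hr hω)] at h1
        refine le_trans (le_of_eq ?_) h1
        simp only [hudef]
        ring
    rw [integral_const_mul, ← hid] at hle
    have := mul_le_mul_of_nonneg_left hle hc0
    rw [ge_iff_le, ← sub_nonneg]
    rw [← sub_nonneg] at this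
    refine this.trans (le_of_eq ?_)
    ring
end

section
/- Uniform lower bound at scale 1/λ for the comparison ODE: for every n ≥ 2 there exists a constant κ > 0, depending only on n, with the following property. For every λ > 0, every A > 0, and every twice differentiable function J : (0, κ/λ) → ℝ satisfying J''(r) + ((n−1)/r)·J'(r) + 2λ²·J(r) = 0 on (0, κ/λ) together with J(r) → A and J'(r) → 0 as r → 0⁺, one has J(r) ≥ A/2 for every r ∈ (0, κ/λ). -/
open Set Filter

/-- Uniform lower bound at scale `1/λ` for the comparison ODE.
For every `n ≥ 2` there is `κ > 0` depending only on `n` such that for all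
`λ > 0`, `A > 0`, and every twice differentiable `J : (0, κ/λ) → ℝ` with
`J'' + ((n-1)/r) J' + 2λ² J = 0` on `(0, κ/λ)`, `J(r) → A` and `J'(r) → 0` as
`r → 0⁺`, one has `J(r) ≥ A/2` on `(0, κ/λ)`. -/
theorem comparison_ode_uniform_lower_bound
    (n : ℕ) (hn : 2 ≤ n) :
    ∃ κ : ℝ, 0 < κ ∧
      ∀ lam : ℝ, 0 < lam → ∀ A : ℝ, 0 < A → ∀ J : ℝ → ℝ,
        (∀ r ∈ Ioo (0 : ℝ) (κ / lam),
          DifferentiableAt ℝ J r ∧ DifferentiableAt ℝ (deriv J) r) →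
        (∀ r ∈ Ioo (0 : ℝ) (κ / lam),
          deriv (deriv J) r + ((n : ℝ) - 1) / r * deriv J r + 2 * lam ^ 2 * J r = 0) →
        Tendsto J (nhdsWithin 0 (Ioi 0)) (nhds A) →
        Tendsto (deriv J) (nhdsWithin 0 (Ioi 0)) (nhds 0) →
        ∀ r ∈ Ioo (0 : ℝ) (κ / lam), A / 2 ≤ J r := by
  refine ⟨1 / 4, by norm_num, ?_⟩
  intro lam hl A hA J hd hode hJ hJ' r hr
  set R : ℝ := 1 / 4 / lam with hR
  have hn1 : (0 : ℝ) ≤ (n : ℝ) - 1 := by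
    have : (2 : ℝ) ≤ n := by exact_mod_cast hn
    linarith
  -- points close to zero lie in the interval
  have hev : ∀ x : ℝ, 0 < x → ∀ᶠ y in nhdsWithin (0 : ℝ) (Ioi 0), y ∈ Ioo 0 x :=
    fun x hx => Ioo_mem_nhdsGT hx
  -- energy
  have hEd : ∀ x ∈ Ioo (0 : ℝ) R,
      HasDerivAt (fun y => deriv J y ^ 2 + 2 * lam ^ 2 * J y ^ 2)
        (-(2 * (((n : ℝ) - 1) / x) * deriv J x ^ 2)) x := by
    intro x hx
    have h1 := (hd x hx).1.hasDerivAt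
    have h2 := (hd x hx).2.hasDerivAt
    have h3 := (h2.pow 2).add ((h1.pow 2).const_mul (2 * lam ^ 2))
    refine h3.congr_deriv ?_
    have h4 := hode x hx
    have h5 : deriv (deriv J) x
        = -(((n : ℝ) - 1) / x * deriv J x) - 2 * lam ^ 2 * J x := by linarith
    rw [h5]
    push_cast
    ring
  have hE : AntitoneOn (fun y => deriv J y ^ 2 + 2 * lam ^ 2 * J y ^ 2) (Ioo (0 : ℝ) R) := by
    refine antitoneOn_of_deriv_nonpos (convex_Ioo _ _)
      (fun x hx => (hEd x hx).continuousAt.continuousWithinAt) ?_ ?_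
    · rw [interior_Ioo]
      exact fun x hx => (hEd x hx).differentiableAt.differentiableWithinAt
    · rw [interior_Ioo]
      intro x hx
      rw [(hEd x hx).deriv]
      have : 0 ≤ ((n : ℝ) - 1) / x := div_nonneg hn1 hx.1.le
      have : 0 ≤ 2 * (((n : ℝ) - 1) / x) * deriv J x ^ 2 := by positivity
      linarith
  have hElim : Tendsto (fun y => deriv J y ^ 2 + 2 * lam ^ 2 * J y ^ 2)
      (nhdsWithin 0 (Ioi 0)) (nhds (0 ^ 2 + 2 * lam ^ 2 * A ^ 2)) :=
    (hJ'.pow 2).add ((hJ.pow 2).const_mul _)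
  have hbound : ∀ x ∈ Ioo (0 : ℝ) R, -(2 * lam * A) ≤ deriv J x := by
    intro x hx
    have h1 := ge_of_tendsto hElim ((hev x hx.1).mono fun y hy =>
      hE ⟨hy.1, hy.2.trans hx.2⟩ hx hy.2.le)
    simp only at h1
    have h2 : 0 ≤ 2 * lam ^ 2 * J x ^ 2 := by positivity
    have h3 : 0 ≤ lam ^ 2 * A ^ 2 := by positivity
    have h4 : 0 ≤ 2 * lam * A := by positivity
    exact (abs_le_of_sq_le_sq' (by nlinarith) h4).1
  have hGd : ∀ x ∈ Ioo (0 : ℝ) R,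
      HasDerivAt (fun y => J y + 2 * lam * A * y) (deriv J x + 2 * lam * A) x := by
    intro x hx
    have h := (hd x hx).1.hasDerivAt.add ((hasDerivAt_id x).const_mul (2 * lam * A))
    exact h.congr_deriv (by ring)
  have hG : MonotoneOn (fun y => J y + 2 * lam * A * y) (Ioo (0 : ℝ) R) := by
    refine monotoneOn_of_deriv_nonneg (convex_Ioo _ _)
      (fun x hx => (hGd x hx).continuousAt.continuousWithinAt) ?_ ?_
    · rw [interior_Ioo]
      exact fun x hx => (hGd x hx).differentiableAt.differentiableWithinAt
    · rw [interior_Ioo]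
      intro x hx
      rw [(hGd x hx).deriv]
      linarith [hbound x hx]
  have hGlim : Tendsto (fun y => J y + 2 * lam * A * y)
      (nhdsWithin 0 (Ioi 0)) (nhds (A + 2 * lam * A * 0)) :=
    hJ.add ((tendsto_id.mono_left nhdsWithin_le_nhds).const_mul _)
  have h1 := le_of_tendsto hGlim ((hev r hr.1).mono fun y hy =>
    hG ⟨hy.1, hy.2.trans hr.2⟩ hr hy.2.le)
  simp only at h1
  have h2 : r * lam < 1 / 4 := (lt_div_iff₀ hl).1 hr.2
  nlinarith
end

section
/- Mean value inequality for eigenfunctions at scale 1/λ: for every n ≥ 2 there exists a constant κ > 0, depending only on n, such that for every λ > 0, every x₀ ∈ ℝⁿ, every R > κ/λ, and every C² function ψ on the ball B_R(x₀) ⊂ ℝⁿ satisfying Δψ = −λ²ψ there, one has ψ(x₀)² ≤ 2·I_{ψ²}(x₀, κ/λ), i.e. the square of the value at the center is at most twice the mean of ψ² over the geodesic sphere ∂B_{κ/λ}(x₀). -/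
open MeasureTheory Metric Set Filter

open scoped InnerProductSpace in
lemma aux_cap_finite {n : ℕ} (hn : 2 ≤ n) (v : EuclideanSpace ℝ (Fin n)) (hv : ‖v‖ = 1) :
    μH[(n : ℝ) - 1] {x : EuclideanSpace ℝ (Fin n) | x ∈ sphere (0 : EuclideanSpace ℝ (Fin n)) 1 ∧
      ⟪v, x⟫_ℝ ≤ 0} < ⊤ := by
  have hv0 : v ≠ 0 := by rintro rfl; simp at hv
  have hfr : (Module.finrank ℝ (ℝ ∙ v)ᗮ : ℝ) = (n : ℝ) - 1 := by
    haveI : Fact (Module.finrank ℝ (EuclideanSpace ℝ (Fin n)) = (n - 1) + 1) :=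
      ⟨by simp; omega⟩
    rw [Submodule.finrank_orthogonal_span_singleton (n := n - 1) hv0]
    push_cast [Nat.cast_sub (show 1 ≤ n by omega)]
    ring
  have hd : (0 : ℝ) ≤ (n : ℝ) - 1 := by rw [← hfr]; positivity
  set f : (ℝ ∙ v)ᗮ → EuclideanSpace ℝ (Fin n) := fun w => stereoInvFunAux v (w : _) with hf
  have hfc : ContDiff ℝ 1 f :=
    contDiff_stereoInvFunAux.comp (ℝ ∙ v)ᗮ.subtypeL.contDiff
  obtain ⟨K, hK⟩ := LocallyLipschitzOn.exists_lipschitzOnWith_of_compact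
    (isCompact_closedBall (0 : (ℝ ∙ v)ᗮ) 2) (hfc.locallyLipschitz.locallyLipschitzOn)
  have hsub : {x : EuclideanSpace ℝ (Fin n) | x ∈ sphere (0 : EuclideanSpace ℝ (Fin n)) 1 ∧
      ⟪v, x⟫_ℝ ≤ 0} ⊆ f '' closedBall 0 2 := by
    rintro x ⟨hx, hxv⟩
    refine ⟨stereoToFun v x, ?_, ?_⟩
    · rw [mem_closedBall_zero_iff, stereoToFun_apply, norm_smul]
      have h1 : ‖(ℝ ∙ v)ᗮ.orthogonalProjectionOnto x‖ ≤ 1 := by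
        have := (ℝ ∙ v)ᗮ.norm_orthogonalProjectionOnto_apply_le x
        rw [mem_sphere_zero_iff_norm] at hx
        linarith
      have h2 : ‖2 / ((1 : ℝ) - innerSL ℝ v x)‖ ≤ 2 := by
        rw [innerSL_apply_apply, Real.norm_eq_abs, abs_of_pos (by apply div_pos <;> linarith)]
        rw [div_le_iff₀ (by linarith)]
        linarith
      calc _ ≤ 2 * (1 : ℝ) := by gcongr
        _ = 2 := by norm_num
    · have := stereo_left_inv hv (x := ⟨x, hx⟩) (by
        rintro h
        simp only at h
        rw [h, real_inner_self_eq_norm_sq, hv] at hxv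
        norm_num at hxv)
      exact congrArg Subtype.val this
  refine (measure_mono hsub).trans_lt ((hK.hausdorffMeasure_image_le hd).trans_lt ?_)
  refine ENNReal.mul_lt_top (ENNReal.rpow_lt_top_of_nonneg hd ENNReal.coe_ne_top) ?_
  rw [← hfr]
  exact (isCompact_closedBall _ _).measure_lt_top

lemma aux_sphere_finite {n : ℕ} (hn : 2 ≤ n) (r : ℝ) :
    μH[(n : ℝ) - 1] (sphere (0 : EuclideanSpace ℝ (Fin n)) r) < ⊤ := by
  have hd : (0 : ℝ) ≤ (n : ℝ) - 1 := by
    have : (2 : ℝ) ≤ n := by exact_mod_cast hn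
    linarith
  rcases lt_trichotomy r 0 with hr | rfl | hr
  · rw [sphere_eq_empty_of_neg hr]; simp
  · rw [sphere_zero]
    have : 0 < (n : ℝ) - 1 := by
      have : (2 : ℝ) ≤ n := by exact_mod_cast hn
      linarith
    haveI := Measure.noAtoms_hausdorff (EuclideanSpace ℝ (Fin n)) this
    simp
  have h1 : μH[(n : ℝ) - 1] (sphere (0 : EuclideanSpace ℝ (Fin n)) 1) < ⊤ := by
    set v : EuclideanSpace ℝ (Fin n) := EuclideanSpace.single ⟨0, by omega⟩ 1
    have hv : ‖v‖ = 1 := by simp [v]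
    refine (measure_mono ?_).trans_lt ((measure_union_le _ _).trans_lt
      (ENNReal.add_lt_top.2 ⟨aux_cap_finite hn v hv, aux_cap_finite hn (-v) (by simpa using hv)⟩))
    intro x hx
    rcases le_total (inner ℝ v x) 0 with h | h
    · exact Or.inl ⟨hx, h⟩
    · exact Or.inr ⟨hx, by simpa using h⟩
  have h2 : sphere (0 : EuclideanSpace ℝ (Fin n)) r ⊆ (fun x => r • x) '' sphere 0 1 := by
    intro x hx
    rw [mem_sphere_zero_iff_norm] at hx
    refine ⟨r⁻¹ • x, ?_, ?_⟩
    · rw [mem_sphere_zero_iff_norm, norm_smul, hx, norm_inv, Real.norm_of_nonneg hr.le]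
      field_simp
    · simp [smul_smul, hr.ne']
  refine (measure_mono h2).trans_lt (((lipschitzWith_smul r).hausdorffMeasure_image_le hd _).trans_lt ?_)
  exact ENNReal.mul_lt_top (ENNReal.rpow_lt_top_of_nonneg hd ENNReal.coe_ne_top) h1

lemma aux_sphere_pos {n : ℕ} (hn : 2 ≤ n) {r : ℝ} (hr : 0 < r) :
    μH[(n : ℝ) - 1] (sphere (0 : EuclideanSpace ℝ (Fin n)) r) ≠ 0 := by
  set v : EuclideanSpace ℝ (Fin n) := EuclideanSpace.single ⟨0, by omega⟩ 1
  have hv : ‖v‖ = 1 := by simp [v]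
  have hv0 : v ≠ 0 := by intro h; simp [h] at hv
  have hfr : (Module.finrank ℝ (ℝ ∙ v)ᗮ : ℝ) = (n : ℝ) - 1 := by
    haveI : Fact (Module.finrank ℝ (EuclideanSpace ℝ (Fin n)) = (n - 1) + 1) :=
      ⟨by simp; omega⟩
    rw [Submodule.finrank_orthogonal_span_singleton (n := n - 1) hv0]
    push_cast [Nat.cast_sub (show 1 ≤ n by omega)]
    ring
  have hd : (0 : ℝ) ≤ (n : ℝ) - 1 := by rw [← hfr]; positivity
  have hle := hausdorffMeasure_orthogonalProjectionOnto_le (ℝ ∙ v)ᗮ ((n : ℝ) - 1)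
    (sphere (0 : EuclideanSpace ℝ (Fin n)) r) hd
  have hsub : ball (0 : (ℝ ∙ v)ᗮ) r ⊆
      (ℝ ∙ v)ᗮ.orthogonalProjectionOnto '' (sphere (0 : EuclideanSpace ℝ (Fin n)) r) := by
    intro w hw
    rw [mem_ball_zero_iff] at hw
    have hwv : inner ℝ v (w : EuclideanSpace ℝ (Fin n)) = 0 :=
      Submodule.mem_orthogonal_singleton_iff_inner_right.mp w.2
    have hnn : 0 ≤ r ^ 2 - ‖w‖ ^ 2 := by nlinarith [norm_nonneg w]
    refine ⟨(w : EuclideanSpace ℝ (Fin n)) + Real.sqrt (r ^ 2 - ‖w‖ ^ 2) • v, ?_, ?_⟩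
    · rw [mem_sphere_zero_iff_norm, ← sq_eq_sq₀ (norm_nonneg _) hr.le,
        norm_add_sq_real, inner_smul_right, real_inner_comm, hwv, norm_smul, hv,
        mul_one, Real.norm_eq_abs, sq_abs, Real.sq_sqrt hnn]
      simp
    · rw [map_add, Submodule.orthogonalProjectionOnto_mem_subspace_eq_self, map_smul]
      rw [Submodule.orthogonalProjectionOnto_orthogonal_apply_eq_zero
        (Submodule.mem_span_singleton_self v)]
      simp
  have hpos : 0 < μH[(n : ℝ) - 1] (ball (0 : (ℝ ∙ v)ᗮ) r) := by
    rw [← hfr]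
    exact measure_ball_pos _ _ hr
  exact (hpos.trans_le ((measure_mono hsub).trans hle)).ne'

lemma aux_integrable {n : ℕ} {ν : Measure (EuclideanSpace ℝ (Fin n))} [IsFiniteMeasure ν] {ρ : ℝ}
    (hs : ∀ᵐ z ∂ν, ‖z‖ = ρ) {f : EuclideanSpace ℝ (Fin n) → ℝ} (hf : Continuous f) :
    Integrable f ν := by
  obtain ⟨C, hC⟩ := (isCompact_sphere (0 : EuclideanSpace ℝ (Fin n)) ρ).exists_bound_of_continuousOn
    hf.continuousOn
  refine Integrable.of_bound hf.aestronglyMeasurable C ?_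
  filter_upwards [hs] with z hz
  exact hC z (by simpa using hz)

lemma aux_deriv {n : ℕ} {ν : Measure (EuclideanSpace ℝ (Fin n))} [IsFiniteMeasure ν] {ρ : ℝ}
    (hs : ∀ᵐ z ∂ν, ‖z‖ = ρ) {F F' : ℝ → EuclideanSpace ℝ (Fin n) → ℝ}
    (hF : ∀ t, Continuous (F t)) (hF' : Continuous (fun p : ℝ × EuclideanSpace ℝ (Fin n) => F' p.1 p.2))
    (hd : ∀ t z, HasDerivAt (fun s => F s z) (F' t z) t) (t : ℝ) :
    HasDerivAt (fun s => ∫ z, F s z ∂ν) (∫ z, F' t z ∂ν) t := by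
  obtain ⟨C, hC⟩ := ((isCompact_closedBall t 1).prod
    (isCompact_sphere (0 : EuclideanSpace ℝ (Fin n)) ρ)).exists_bound_of_continuousOn
    hF'.continuousOn
  refine (hasDerivAt_integral_of_dominated_loc_of_deriv_le (closedBall_mem_nhds t one_pos)
    (Eventually.of_forall fun s => (hF s).aestronglyMeasurable) (aux_integrable hs (hF t))
    (F' := F') (bound := fun _ => C) ?_ ?_ (integrable_const C) ?_).2
  · exact (hF'.comp (by fun_prop : Continuous fun z => (t, z))).aestronglyMeasurable
  · filter_upwards [hs] with z hz s hs'
    exact hC (s, z) ⟨hs', by simpa using hz⟩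
  · exact Eventually.of_forall fun z s _ => hd s z

noncomputable def auxRot {n : ℕ} (i j : Fin n) (θ : ℝ) :
    EuclideanSpace ℝ (Fin n) →ₗ[ℝ] EuclideanSpace ℝ (Fin n) where
  toFun z := z + ((Real.cos θ - 1) * z i - Real.sin θ * z j) • EuclideanSpace.single i (1 : ℝ)
    + (Real.sin θ * z i + (Real.cos θ - 1) * z j) • EuclideanSpace.single j (1 : ℝ)
  map_add' x y := by
    simp only [PiLp.add_apply]
    module
  map_smul' c x := by
    simp only [PiLp.smul_apply, smul_eq_mul, RingHom.id_apply]
    module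

lemma auxRot_norm {n : ℕ} {i j : Fin n} (hij : i ≠ j) (θ : ℝ) (z : EuclideanSpace ℝ (Fin n)) :
    ‖auxRot i j θ z‖ = ‖z‖ := by
  rw [← sq_eq_sq₀ (norm_nonneg _) (norm_nonneg _)]
  simp only [auxRot, LinearMap.coe_mk, AddHom.coe_mk]
  rw [norm_add_sq_real, norm_add_sq_real, inner_add_left]
  simp only [inner_smul_left, inner_smul_right, EuclideanSpace.inner_single_right, norm_smul,
    EuclideanSpace.norm_single, PiLp.single_apply, mul_pow]
  simp [hij.symm]
  have := Real.sin_sq_add_cos_sq θ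
  generalize Real.sin θ = s at *
  generalize Real.cos θ = c at *
  linear_combination (z i ^ 2 + z j ^ 2) * this

lemma aux_rot_inv {n : ℕ} {ν : Measure (EuclideanSpace ℝ (Fin n))}
    (hinv : ∀ e : EuclideanSpace ℝ (Fin n) ≃ₗᵢ[ℝ] EuclideanSpace ℝ (Fin n), MeasurePreserving e ν ν)
    (g : EuclideanSpace ℝ (Fin n) → ℝ) {i j : Fin n} (hij : i ≠ j) (θ : ℝ) :
    ∫ z, g (auxRot i j θ z) ∂ν = ∫ z, g z ∂ν := by
  let e : EuclideanSpace ℝ (Fin n) ≃ₗᵢ[ℝ] EuclideanSpace ℝ (Fin n) :=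
    LinearIsometry.toLinearIsometryEquiv ⟨auxRot i j θ, auxRot_norm hij θ⟩ rfl
  have he : ∀ z, e z = auxRot i j θ z := fun z => rfl
  have := (hinv e).integral_comp e.toHomeomorph.measurableEmbedding g
  simpa only [he] using this

lemma auxRot_deriv {n : ℕ} (i j : Fin n) (z : EuclideanSpace ℝ (Fin n)) (θ : ℝ) :
    HasDerivAt (fun θ => auxRot i j θ z)
     ((-Real.sin θ * z i - Real.cos θ * z j) • EuclideanSpace.single i (1 : ℝ)
    + (Real.cos θ * z i + (-Real.sin θ) * z j) • EuclideanSpace.single j (1 : ℝ)) θ := by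
  have h1 : HasDerivAt (fun θ => (Real.cos θ - 1) * z i - Real.sin θ * z j)
      (-Real.sin θ * z i - Real.cos θ * z j) θ :=
    (((Real.hasDerivAt_cos θ).sub_const 1).mul_const _).sub
        ((Real.hasDerivAt_sin θ).mul_const _)
  have h2 : HasDerivAt (fun θ => Real.sin θ * z i + (Real.cos θ - 1) * z j)
      (Real.cos θ * z i + (-Real.sin θ) * z j) θ :=
    ((Real.hasDerivAt_sin θ).mul_const _).add
        (((Real.hasDerivAt_cos θ).sub_const 1).mul_const _)
  exact ((h1.smul_const (EuclideanSpace.single i (1 : ℝ))).const_add z).add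
    (h2.smul_const (EuclideanSpace.single j (1 : ℝ)))

lemma aux_rot {n : ℕ} {ν : Measure (EuclideanSpace ℝ (Fin n))} [IsFiniteMeasure ν] {ρ : ℝ}
    (hs : ∀ᵐ z ∂ν, ‖z‖ = ρ)
    (hinv : ∀ e : EuclideanSpace ℝ (Fin n) ≃ₗᵢ[ℝ] EuclideanSpace ℝ (Fin n), MeasurePreserving e ν ν)
    {g : EuclideanSpace ℝ (Fin n) → ℝ} {g' : EuclideanSpace ℝ (Fin n) → EuclideanSpace ℝ (Fin n) →L[ℝ] ℝ}
    (hg : ∀ z, HasFDerivAt g (g' z) z) (hg' : Continuous g') (i j : Fin n) :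
    ∫ z, g' z (z i • EuclideanSpace.single j (1 : ℝ) - z j • EuclideanSpace.single i (1 : ℝ)) ∂ν = 0 := by
  by_cases hij : i = j
  · subst hij; simp
  have hgc : Continuous g := continuous_iff_continuousAt.2 fun z => (hg z).continuousAt
  set V : ℝ → EuclideanSpace ℝ (Fin n) → EuclideanSpace ℝ (Fin n) := fun θ z =>
    (-Real.sin θ * z i - Real.cos θ * z j) • EuclideanSpace.single i (1 : ℝ)
    + (Real.cos θ * z i + (-Real.sin θ) * z j) • EuclideanSpace.single j (1 : ℝ) with hV
  obtain ⟨Rf, hRf⟩ : ∃ Rf : ℝ → EuclideanSpace ℝ (Fin n) → EuclideanSpace ℝ (Fin n),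
    ∀ θ z, Rf θ z = auxRot i j θ z := ⟨_, fun _ _ => rfl⟩
  have hRV : ∀ z θ, HasDerivAt (fun θ => Rf θ z) (V θ z) θ := by
    intro z θ
    simp only [hRf]
    exact auxRot_deriv i j z θ
  have hRc : Continuous fun p : ℝ × EuclideanSpace ℝ (Fin n) => Rf p.1 p.2 := by
    simp only [hRf, auxRot, LinearMap.coe_mk, AddHom.coe_mk]
    fun_prop
  have k1 : ∀ θ, Continuous fun z => g (Rf θ z) := by
    intro θ
    have : Continuous fun z => Rf θ z := hRc.comp (Continuous.prodMk_right θ)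
    exact hgc.comp this
  have hVc : Continuous fun p : ℝ × EuclideanSpace ℝ (Fin n) => V p.1 p.2 := by
    simp only [hV]; fun_prop
  have k2 : Continuous fun p : ℝ × EuclideanSpace ℝ (Fin n) =>
      g' (Rf p.1 p.2) (V p.1 p.2) := (hg'.comp hRc).clm_apply hVc
  have k3 : ∀ θ z, HasDerivAt (fun θ => g (Rf θ z)) (g' (Rf θ z) (V θ z)) θ := by
    intro θ z
    have h1 := hg (Rf θ z)
    have h2 := hRV z θ
    exact h1.comp_hasDerivAt θ h2
  have hD := aux_deriv (ν := ν) hs (F := fun θ z => g (Rf θ z))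
    (F' := fun θ z => g' (Rf θ z) (V θ z)) k1 k2 k3 0
  have hconst : (fun θ => ∫ z, g (Rf θ z) ∂ν) = fun _ => ∫ z, g z ∂ν := by
    funext θ
    simp only [hRf]
    exact aux_rot_inv hinv g hij θ
  rw [hconst] at hD
  have h0 := hD.unique (hasDerivAt_const 0 _)
  have hR0 : ∀ z, Rf 0 z = z := by intro z; simp [hRf, auxRot]
  have hV0 : ∀ z, V 0 z = z i • EuclideanSpace.single j (1 : ℝ) - z j • EuclideanSpace.single i (1 : ℝ) := by
    intro z
    simp only [hV, Real.sin_zero, Real.cos_zero]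
    module
  simp only [hR0, hV0] at h0
  exact h0

lemma aux_basis {n : ℕ} (z : EuclideanSpace ℝ (Fin n)) :
    z = ∑ i, z i • EuclideanSpace.single i (1 : ℝ) := by
  ext k
  simp [Pi.single_apply]

lemma aux_ode {n : ℕ} {ν : Measure (EuclideanSpace ℝ (Fin n))} [IsFiniteMeasure ν] {ρ : ℝ}
    (hs : ∀ᵐ z ∂ν, ‖z‖ = ρ)
    (hinv : ∀ e : EuclideanSpace ℝ (Fin n) ≃ₗᵢ[ℝ] EuclideanSpace ℝ (Fin n), MeasurePreserving e ν ν)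
    {u : EuclideanSpace ℝ (Fin n) → ℝ} (hu : ContDiff ℝ 2 u) (t : ℝ) :
    ((n : ℝ) - 1) * ∫ z, fderiv ℝ u (t • z) z ∂ν + t * ∫ z, fderiv ℝ (fderiv ℝ u) (t • z) z z ∂ν
      = t * ρ ^ 2 * ∫ z, lap u (t • z) ∂ν := by
  have hu1 : ContDiff ℝ 1 (fderiv ℝ u) := hu.fderiv_right (by norm_num)
  have hu1d : ∀ x, HasFDerivAt (fderiv ℝ u) (fderiv ℝ (fderiv ℝ u) x) x := fun x =>
    (hu1.differentiable (by norm_num) x).hasFDerivAt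
  have hc1 : Continuous (fderiv ℝ u) := hu1.continuous
  have hc2 : Continuous (fderiv ℝ (fderiv ℝ u)) := hu1.continuous_fderiv (by norm_num)
  have hlap : ∀ x, lap u x = ∑ i, fderiv ℝ (fderiv ℝ u) x (EuclideanSpace.single i 1)
      (EuclideanSpace.single i 1) := by
    intro x
    unfold lap
    refine Finset.sum_congr rfl fun i _ => ?_
    rw [((hu1d x).clm_apply (hasFDerivAt_const (EuclideanSpace.single i (1 : ℝ)) x)).fderiv]
    simp
  have hlapc : Continuous (lap u) := by
    have : lap u = _ := funext hlap
    rw [this]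
    fun_prop
  set G : Fin n → Fin n → EuclideanSpace ℝ (Fin n) → EuclideanSpace ℝ (Fin n) →L[ℝ] ℝ :=
    fun i j z => (z i * t) • (fderiv ℝ (fderiv ℝ u) (t • z)).flip (EuclideanSpace.single j 1)
      + (fderiv ℝ u (t • z) (EuclideanSpace.single j 1)) • EuclideanSpace.proj i with hG
  have hGd : ∀ i j z, HasFDerivAt
      (fun z : EuclideanSpace ℝ (Fin n) => z i * fderiv ℝ u (t • z) (EuclideanSpace.single j 1))
      (G i j z) z := by
    intro i j z
    have h1 : HasFDerivAt (fun z : EuclideanSpace ℝ (Fin n) => z i)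
      (EuclideanSpace.proj (𝕜 := ℝ) i : EuclideanSpace ℝ (Fin n) →L[ℝ] ℝ) z :=
      (EuclideanSpace.proj (𝕜 := ℝ) i : EuclideanSpace ℝ (Fin n) →L[ℝ] ℝ).hasFDerivAt
    have h2 : HasFDerivAt (fun z : EuclideanSpace ℝ (Fin n) => t • z)
      (t • ContinuousLinearMap.id ℝ (EuclideanSpace ℝ (Fin n))) z := (hasFDerivAt_id z).const_smul t
    have h3 := (((hu1d (t • z)).comp z h2).clm_apply
      (hasFDerivAt_const (EuclideanSpace.single j (1 : ℝ)) z))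
    refine (h1.mul h3).congr_fderiv ?_
    ext w
    simp [hG]
    ring
  have hGc : ∀ i j, Continuous (G i j) := by
    intro i j
    have h1 : Continuous fun z => fderiv ℝ (fderiv ℝ u) (t • z) := hc2.comp (continuous_const_smul t)
    have h2 : Continuous fun z => (fderiv ℝ (fderiv ℝ u) (t • z)).flip :=
      (ContinuousLinearMap.flipₗᵢ ℝ (EuclideanSpace ℝ (Fin n)) (EuclideanSpace ℝ (Fin n)) ℝ).continuous.comp h1
    have h3 : Continuous fun z =>
        (fderiv ℝ (fderiv ℝ u) (t • z)).flip (EuclideanSpace.single j (1 : ℝ)) :=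
      h2.clm_apply continuous_const
    have h4 : Continuous fun z => fderiv ℝ u (t • z) (EuclideanSpace.single j (1 : ℝ)) := by
      fun_prop
    have h5 : Continuous fun z : EuclideanSpace ℝ (Fin n) => z i * t := by fun_prop
    exact (h5.smul h3).add (h4.smul continuous_const)
  have hsum : ∑ i, ∑ j, ∫ z, G i j z
      (z i • EuclideanSpace.single j (1 : ℝ) - z j • EuclideanSpace.single i (1 : ℝ)) ∂ν = 0 :=
    Finset.sum_eq_zero fun i _ => Finset.sum_eq_zero fun j _ => aux_rot hs hinv (hGd i j) (hGc i j) i j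
  have hI : ∀ i j, Integrable (fun z => G i j z
      (z i • EuclideanSpace.single j (1 : ℝ) - z j • EuclideanSpace.single i (1 : ℝ))) ν := by
    intro i j
    refine aux_integrable hs ((hGc i j).clm_apply (by fun_prop))
  have hpt : ∀ z, ∑ i, ∑ j, G i j z
      (z i • EuclideanSpace.single j (1 : ℝ) - z j • EuclideanSpace.single i (1 : ℝ))
      = t * (‖z‖ ^ 2 * lap u (t • z)) - (((n : ℝ) - 1) * fderiv ℝ u (t • z) z
        + t * fderiv ℝ (fderiv ℝ u) (t • z) z z) := by
    intro z
    set A := fderiv ℝ u (t • z) with hA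
    set B := fderiv ℝ (fderiv ℝ u) (t • z) with hB
    have eA : A z = ∑ j, z j * A (EuclideanSpace.single j 1) := by
      conv_lhs => rw [aux_basis z]
      simp
    have eB : B z z = ∑ i, ∑ j, z i * (z j * B (EuclideanSpace.single i 1) (EuclideanSpace.single j 1)) := by
      conv_lhs => rw [aux_basis z]
      simp only [map_sum, map_smul, ContinuousLinearMap.sum_apply, ContinuousLinearMap.smul_apply,
        smul_eq_mul, Finset.mul_sum]
      rw [Finset.sum_comm]
      refine Finset.sum_congr rfl fun i _ => Finset.sum_congr rfl fun j _ => ?_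
      ring
    have eN : ‖z‖ ^ 2 = ∑ i, z i ^ 2 := by
      simp [EuclideanSpace.norm_sq_eq]
    rw [hlap, ← hB, eA, eB, eN]
    have key : ∀ i j, G i j z
      (z i • EuclideanSpace.single j (1 : ℝ) - z j • EuclideanSpace.single i (1 : ℝ))
      = t * (z i ^ 2 * B (EuclideanSpace.single j 1) (EuclideanSpace.single j 1))
        - (z j * A (EuclideanSpace.single j 1)
        + t * (z i * (z j * B (EuclideanSpace.single i 1) (EuclideanSpace.single j 1))))
        + (if i = j then z j * A (EuclideanSpace.single j 1) else 0) := by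
      intro i j
      simp only [hG, ← hA, ← hB]
      simp [Pi.single_apply]
      split_ifs with h
      · subst h; ring
      · ring
    simp_rw [key]
    simp only [Finset.sum_add_distrib, Finset.sum_sub_distrib, Finset.mul_sum]
    simp [← Finset.mul_sum, ← Finset.sum_mul]
    ring
  rw [← integral_const_mul, ← integral_const_mul, ← integral_const_mul, ← sub_eq_zero,
    ← integral_add, ← integral_sub]
  rotate_left
  · exact aux_integrable hs (by fun_prop)
  · exact aux_integrable hs (by fun_prop)
  · exact aux_integrable hs (by fun_prop)
  · exact aux_integrable hs (by fun_prop)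
  rw [← neg_eq_zero, ← integral_neg, ← hsum]
  simp_rw [← integral_finsetSum _ (fun j _ => hI _ j)]
  rw [← integral_finsetSum _ (fun i _ => integrable_finsetSum _ (fun j _ => hI i j))]
  refine integral_congr_ae ?_
  filter_upwards [hs] with z hz
  rw [hpt z, hz]
  ring

lemma aux_est {m : ℕ} (hm : 1 ≤ m) {J J1 J2 : ℝ → ℝ} (h1 : ∀ t, HasDerivAt J (J1 t) t)
    (h2 : ∀ t, HasDerivAt J1 (J2 t) t)
    (hode : ∀ t ∈ Icc (0 : ℝ) 1, (m : ℝ) * J1 t + t * J2 t = -(1 / 16) * t * J t) :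
    J 0 ^ 2 ≤ 2 * J 1 ^ 2 := by
  have hJc : Continuous J := continuous_iff_continuousAt.2 fun z => (h1 z).continuousAt
  obtain ⟨s, hs, hM⟩ := isCompact_Icc.exists_isMaxOn (nonempty_Icc.2 (zero_le_one' ℝ))
    hJc.abs.continuousOn
  set M := |J s| with hMdef
  have hM' : ∀ t ∈ Icc (0 : ℝ) 1, |J t| ≤ M := fun t ht => hM ht
  have hM0 : 0 ≤ M := abs_nonneg _
  have hP : ∀ t ∈ Icc (0 : ℝ) 1, HasDerivAt (fun t => t ^ m * J1 t) (-(1 / 16) * t ^ m * J t) t := by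
    intro t ht
    refine ((hasDerivAt_pow m t).mul (h2 t)).congr_deriv ?_
    obtain ⟨k, rfl⟩ : ∃ k, m = k + 1 := ⟨m - 1, by omega⟩
    have := hode t ht
    simp only [Nat.add_sub_cancel]
    linear_combination t ^ k * this
  have hJ1 : ∀ t ∈ Icc (0 : ℝ) 1, |J1 t| ≤ M / 16 := by
    intro t ht
    rcases ht.1.eq_or_lt with rfl | htp
    · have := hode 0 ht
      have hm' : (m : ℝ) ≠ 0 := by positivity
      have : J1 0 = 0 := by simpa [hm'] using this
      rw [this]; simp; positivity
    have hsub : ∀ x ∈ Icc (0 : ℝ) t, x ∈ Icc (0 : ℝ) 1 := fun x hx => ⟨hx.1, hx.2.trans ht.2⟩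
    have := (convex_Icc (0 : ℝ) t).norm_image_sub_le_of_norm_hasDerivWithin_le
      (fun x hx => (hP x (hsub x hx)).hasDerivWithinAt) (C := M / 16 * t ^ m) (by
        intro x hx
        rw [Real.norm_eq_abs, abs_mul, abs_mul, abs_of_nonneg (pow_nonneg hx.1 m)]
        have h1 := hM' x (hsub x hx)
        have h2 : x ^ m ≤ t ^ m := pow_le_pow_left₀ hx.1 hx.2 m
        have h3 : x ^ m * |J x| ≤ t ^ m * M := by
          apply mul_le_mul h2 h1 (abs_nonneg _) (by positivity)
        rw [abs_neg, abs_of_pos (by norm_num : (0 : ℝ) < 1 / 16)]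
        linarith) (left_mem_Icc.2 ht.1) (right_mem_Icc.2 ht.1)
    rw [zero_pow (by omega), zero_mul, sub_zero, sub_zero, Real.norm_eq_abs, Real.norm_eq_abs,
      abs_mul, abs_of_pos htp, abs_of_pos (by positivity)] at this
    have h4 : t ^ m * |J1 t| ≤ t ^ m * (M / 16) := by
      refine this.trans ?_
      have : 0 ≤ M / 16 * t ^ m := by positivity
      nlinarith [ht.2]
    exact le_of_mul_le_mul_left h4 (by positivity)
  have hdiff : ∀ t ∈ Icc (0 : ℝ) 1, |J t - J 0| ≤ M / 16 := by
    intro t ht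
    have := (convex_Icc (0 : ℝ) 1).norm_image_sub_le_of_norm_hasDerivWithin_le
      (fun x _ => (h1 x).hasDerivWithinAt) hJ1 (left_mem_Icc.2 zero_le_one) ht
    rw [Real.norm_eq_abs, Real.norm_eq_abs, sub_zero, abs_of_nonneg ht.1] at this
    nlinarith [ht.2]
  have a := hdiff s hs
  have b := hdiff 1 (right_mem_Icc.2 zero_le_one)
  have a' : M ≤ |J 0| + M / 16 := by
    have := abs_sub_abs_le_abs_sub (J s) (J 0)
    linarith
  have b' : |J 0| ≤ |J 1| + M / 16 := by
    have := abs_sub_abs_le_abs_sub (J 0) (J 1)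
    rw [abs_sub_comm] at this
    linarith
  rw [← sq_abs (J 0), ← sq_abs (J 1)]
  nlinarith [abs_nonneg (J 0), abs_nonneg (J 1)]

lemma aux_main {n : ℕ} (hn : 2 ≤ n) {ν : Measure (EuclideanSpace ℝ (Fin n))} [IsFiniteMeasure ν]
    [NeZero ν] {ρ lam : ℝ} (hρ : 0 ≤ ρ) (hρl : ρ * lam = 1 / 4)
    (hs : ∀ᵐ z ∂ν, ‖z‖ = ρ)
    (hinv : ∀ e : EuclideanSpace ℝ (Fin n) ≃ₗᵢ[ℝ] EuclideanSpace ℝ (Fin n), MeasurePreserving e ν ν)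
    {u : EuclideanSpace ℝ (Fin n) → ℝ} (hu : ContDiff ℝ 2 u)
    (hlap : ∀ z, ‖z‖ ≤ ρ → lap u z = -lam ^ 2 * u z) :
    u 0 ^ 2 ≤ 2 * ⨍ z, u z ^ 2 ∂ν := by
  have hu0 : Continuous u := hu.continuous
  have hu1 : ContDiff ℝ 1 (fderiv ℝ u) := hu.fderiv_right (by norm_num)
  have hd0 : ∀ x, HasFDerivAt u (fderiv ℝ u x) x := fun x =>
    (hu.differentiable (by norm_num) x).hasFDerivAt
  have hd1 : ∀ x, HasFDerivAt (fderiv ℝ u) (fderiv ℝ (fderiv ℝ u) x) x := fun x =>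
    (hu1.differentiable (by norm_num) x).hasFDerivAt
  have hc1 : Continuous (fderiv ℝ u) := hu1.continuous
  have hc2 : Continuous (fderiv ℝ (fderiv ℝ u)) := hu1.continuous_fderiv (by norm_num)
  have hsm : ∀ (t : ℝ) (z : EuclideanSpace ℝ (Fin n)), HasDerivAt (fun s : ℝ => s • z) z t := by
    intro t z
    simpa using (hasDerivAt_id t).smul_const z
  have k1 : ∀ (t : ℝ) (z : EuclideanSpace ℝ (Fin n)),
      HasDerivAt (fun s : ℝ => u (s • z)) (fderiv ℝ u (t • z) z) t := by
    intro t z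
    have h1 := hd0 (t • z)
    have h2 := hsm t z
    exact h1.comp_hasDerivAt t h2
  have k2 : ∀ (t : ℝ) (z : EuclideanSpace ℝ (Fin n)),
      HasDerivAt (fun s : ℝ => fderiv ℝ u (s • z) z) (fderiv ℝ (fderiv ℝ u) (t • z) z z) t := by
    intro t z
    have h1 : HasFDerivAt (fun x => fderiv ℝ u x z) ((fderiv ℝ (fderiv ℝ u) (t • z)).flip z) (t • z) := by
      refine ((hd1 (t • z)).clm_apply (hasFDerivAt_const z (t • z))).congr_fderiv ?_
      ext w
      simp
    have h2 := hsm t z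
    exact h1.comp_hasDerivAt t h2
  have h1 := aux_deriv hs (F := fun t z => u (t • z)) (F' := fun t z => fderiv ℝ u (t • z) z)
    (fun t => by fun_prop) (by fun_prop)
    k1
  have h2 := aux_deriv hs (F := fun t z => fderiv ℝ u (t • z) z)
    (F' := fun t z => fderiv ℝ (fderiv ℝ u) (t • z) z z)
    (fun t => by fun_prop) (by fun_prop) k2
  have hest := aux_est (m := n - 1) (by omega) h1 h2 (by
    intro t ht
    have := aux_ode hs hinv hu t
    rw [Nat.cast_sub (by omega), Nat.cast_one, this]
    have hl : ∫ z, lap u (t • z) ∂ν = -lam ^ 2 * ∫ z, u (t • z) ∂ν := by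
      rw [← integral_const_mul]
      refine integral_congr_ae ?_
      filter_upwards [hs] with z hz
      refine hlap _ ?_
      rw [norm_smul, hz, Real.norm_of_nonneg ht.1]
      nlinarith [ht.2]
    rw [hl]
    have : ρ ^ 2 * lam ^ 2 = 1 / 16 := by rw [← mul_pow, hρl]; norm_num
    linear_combination (-t * ∫ z, u (t • z) ∂ν) * this)
  simp only [zero_smul, one_smul, integral_const, smul_eq_mul] at hest
  have hjen := ConvexOn.map_average_le (μ := ν) (f := u) (g := fun x : ℝ => x ^ 2) (s := univ)
    (even_two.convexOn_pow) (by fun_prop) isClosed_univ (by simp) (aux_integrable hs hu0)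
    (aux_integrable hs (by fun_prop))
  refine le_trans ?_ (mul_le_mul_of_nonneg_left hjen (by norm_num))
  rw [average_eq, smul_eq_mul]
  have hV : 0 < ν.real univ := by
    rw [measureReal_def]
    exact ENNReal.toReal_pos (by simpa using NeZero.ne ν) (measure_ne_top _ _)
  rw [mul_pow, inv_pow, ← mul_assoc, mul_comm 2, mul_assoc, le_inv_mul_iff₀ (by positivity),
    ← mul_pow]
  exact hest

lemma aux_lap_congr {n : ℕ} {f g : EuclideanSpace ℝ (Fin n) → ℝ} {x : EuclideanSpace ℝ (Fin n)}
    (h : f =ᶠ[nhds x] g) : lap f x = lap g x := by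
  unfold lap
  refine Finset.sum_congr rfl fun i _ => ?_
  have : (fun y => fderiv ℝ f y (EuclideanSpace.single i (1 : ℝ))) =ᶠ[nhds x]
      fun y => fderiv ℝ g y (EuclideanSpace.single i (1 : ℝ)) := by
    filter_upwards [h.fderiv (𝕜 := ℝ)] with y hy
    rw [hy]
  rw [this.fderiv_eq]

lemma aux_lap_translate {n : ℕ} (f : EuclideanSpace ℝ (Fin n) → ℝ) (a x : EuclideanSpace ℝ (Fin n)) :
    lap (fun z => f (a + z)) x = lap f (a + x) := by
  unfold lap
  refine Finset.sum_congr rfl fun i _ => ?_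
  simp_rw [fderiv_comp_add_left a]
  rw [fderiv_comp_add_left (f := fun y => fderiv ℝ f y (EuclideanSpace.single i (1 : ℝ))) a]

lemma aux_mean_translate {n : ℕ} (f : EuclideanSpace ℝ (Fin n) → ℝ) (a : EuclideanSpace ℝ (Fin n))
    (r : ℝ) : sphericalMean f a r =
      ⨍ z in sphere (0 : EuclideanSpace ℝ (Fin n)) r, f (a + z) ∂(μH[(n : ℝ) - 1]) := by
  have hmp := (IsometryEquiv.addLeft a).measurePreserving_hausdorffMeasure ((n : ℝ) - 1)
  have hpre : (IsometryEquiv.addLeft a) ⁻¹' (sphere a r) = sphere 0 r := by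
    ext z; simp
  have hme : MeasurableEmbedding (IsometryEquiv.addLeft a) :=
    (IsometryEquiv.addLeft a).toHomeomorph.measurableEmbedding
  unfold sphericalMean
  rw [setAverage_eq, setAverage_eq, ← hmp.setIntegral_preimage_emb hme f (sphere a r),
    measureReal_def, measureReal_def, ← hmp.measure_preimage_emb hme (sphere a r), hpre]
  rfl

lemma aux_extend {n : ℕ} {f : EuclideanSpace ℝ (Fin n) → ℝ} {ρ R : ℝ} (hρ : 0 < ρ) (hR : ρ < R)
    (hf : ContDiffOn ℝ 2 f (ball 0 R)) :
    ∃ u : EuclideanSpace ℝ (Fin n) → ℝ, ContDiff ℝ 2 u ∧ ∀ z, ‖z‖ ≤ ρ → u =ᶠ[nhds z] f := by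
  let b : ContDiffBump (0 : EuclideanSpace ℝ (Fin n)) :=
    ⟨(2 * ρ + R) / 3, (ρ + 2 * R) / 3, by linarith, by linarith⟩
  refine ⟨fun z => b z * f z, ?_, ?_⟩
  · refine contDiff_of_contDiffOn_union_of_isOpen (s := ball 0 R) (t := (closedBall 0 b.rOut)ᶜ)
      (b.contDiff.contDiffOn.mul hf) ?_ ?_ isOpen_ball isClosed_closedBall.isOpen_compl
    · refine (contDiffOn_const (c := (0 : ℝ))).congr fun z hz => ?_
      rw [b.zero_of_le_dist, zero_mul]
      rw [mem_compl_iff, mem_closedBall, not_le] at hz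
      exact hz.le
    · rw [eq_univ_iff_forall]
      intro z
      by_cases hz : z ∈ ball (0 : EuclideanSpace ℝ (Fin n)) R
      · exact Or.inl hz
      · right
        rw [mem_ball, not_lt] at hz
        rw [mem_compl_iff, mem_closedBall, not_le]
        change (ρ + 2 * R) / 3 < _
        linarith
  · intro z hz
    have : z ∈ ball (0 : EuclideanSpace ℝ (Fin n)) b.rIn := by
      rw [mem_ball_zero_iff]
      change _ < (2 * ρ + R) / 3
      linarith
    filter_upwards [b.eventuallyEq_one_of_mem_ball this] with y hy
    rw [hy]; simp

/-- Mean value inequality for eigenfunctions at scale `1/λ`.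
For every `n ≥ 2` there is `κ > 0` depending only on `n` such that for all
`λ > 0`, `x₀ ∈ ℝⁿ`, `R > κ/λ`, and `ψ` of class `C²` on `B_R(x₀)` with
`Δψ = -λ²ψ` there, `ψ(x₀)² ≤ 2 · I_{ψ²}(x₀, κ/λ)`. -/
theorem mean_value_inequality_eigenfunctions
    (n : ℕ) (hn : 2 ≤ n) :
    ∃ κ : ℝ, 0 < κ ∧
      ∀ lam : ℝ, 0 < lam → ∀ x₀ : EuclideanSpace ℝ (Fin n), ∀ R : ℝ, κ / lam < R →
        ∀ ψ : EuclideanSpace ℝ (Fin n) → ℝ,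
          ContDiffOn ℝ 2 ψ (ball x₀ R) →
          (∀ y ∈ ball x₀ R, lap ψ y = -lam ^ 2 * ψ y) →
          ψ x₀ ^ 2 ≤ 2 * sphericalMean (fun y => ψ y ^ 2) x₀ (κ / lam) := by
  refine ⟨1 / 4, by norm_num, ?_⟩
  intro lam hlam x₀ R hR ψ hψ hl
  set ρ : ℝ := 1 / 4 / lam with hρdef
  have hρ : 0 < ρ := by positivity
  have hρl : ρ * lam = 1 / 4 := by rw [hρdef]; field_simp
  have hmaps : MapsTo (fun z => x₀ + z) (ball 0 R) (ball x₀ R) := by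
    intro z hz
    simpa using hz
  have hf : ContDiffOn ℝ 2 (fun z => ψ (x₀ + z)) (ball 0 R) :=
    hψ.comp (contDiff_const.add contDiff_id).contDiffOn hmaps
  obtain ⟨u, hu, huf⟩ := aux_extend hρ hR hf
  set ν : Measure (EuclideanSpace ℝ (Fin n)) :=
    (μH[(n : ℝ) - 1]).restrict (sphere (0 : EuclideanSpace ℝ (Fin n)) ρ) with hν
  have hfin : IsFiniteMeasure ν := ⟨by rw [hν, Measure.restrict_apply_univ]; exact aux_sphere_finite hn ρ⟩
  have hne : NeZero ν := ⟨by
    rw [hν, Ne, Measure.restrict_eq_zero]; exact aux_sphere_pos hn hρ⟩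
  have hs : ∀ᵐ z ∂ν, ‖z‖ = ρ := by
    filter_upwards [ae_restrict_mem isClosed_sphere.measurableSet] with z hz
    simpa using hz
  have hinv : ∀ e : EuclideanSpace ℝ (Fin n) ≃ₗᵢ[ℝ] EuclideanSpace ℝ (Fin n),
      MeasurePreserving e ν ν := by
    intro e
    have h := (e.toIsometryEquiv.measurePreserving_hausdorffMeasure ((n : ℝ) - 1)).restrict_preimage
      (isClosed_sphere (x := (0 : EuclideanSpace ℝ (Fin n))) (ε := ρ)).measurableSet
    have hpre : e.toIsometryEquiv ⁻¹' (sphere (0 : EuclideanSpace ℝ (Fin n)) ρ) = sphere 0 ρ := by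
      ext z; simp
    rw [hpre] at h
    exact h
  have hmain := aux_main hn hρ.le hρl hs hinv hu (by
    intro z hz
    rw [aux_lap_congr (huf z hz), aux_lap_translate, (huf z hz).eq_of_nhds]
    refine hl _ (hmaps ?_)
    rw [mem_ball_zero_iff]
    linarith)
  rw [(huf 0 (by simpa using hρ.le)).eq_of_nhds, add_zero] at hmain
  rw [aux_mean_translate]
  refine hmain.trans_eq ?_
  congr 1
  rw [average_eq, average_eq]
  congr 1
  refine integral_congr_ae ?_
  filter_upwards [hs] with z hz
  rw [(huf z hz.le).eq_of_nhds]
end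

section
/- Local Hörmander-type bound from restriction to a small sphere (L² version): for every n ≥ 2 there exist constants κ > 0 and C > 0, depending only on n, such that for every λ > 0, every x₀ ∈ ℝⁿ, every R > κ/λ, and every C² function ψ on the ball B_R(x₀) ⊂ ℝⁿ satisfying Δψ = −λ²ψ there, one has |ψ(x₀)| ≤ C·λ^{(n−1)/2}·( ∫_{∂B_{κ/λ}(x₀)} ψ(y)² dσ(y) )^{1/2}, where the integral is taken over the sphere of radius κ/λ centered at x₀ with respect to the (n−1)-dimensional surface measure σ. -/
open MeasureTheory Metric Set Filter

theorem lh_ode (M M1 M2 : ℝ → ℝ) (k m : ℝ) (hk : 0 < k) (hm : 0 ≤ m)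
    (h1 : ∀ t, HasDerivAt M (M1 t) t) (h2 : ∀ t, HasDerivAt M1 (M2 t) t)
    (h0 : M1 0 = 0)
    (hode : ∀ t ∈ Icc (0:ℝ) 1, t * M2 t + m * M1 t = -(k ^ 2 * t * M t)) :
    (1 - k) * |M 0| ≤ |M 1| := by
  have hE : ∀ t, HasDerivAt (fun t => M1 t ^ 2 + k ^ 2 * M t ^ 2)
      (2 * M1 t * (M2 t + k ^ 2 * M t)) t := by
    intro t
    refine (((h2 t).pow 2).add (((h1 t).pow 2).const_mul (k ^ 2))).congr_deriv ?_
    simp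
    ring
  have hanti : AntitoneOn (fun t => M1 t ^ 2 + k ^ 2 * M t ^ 2) (Icc (0:ℝ) 1) := by
    apply antitoneOn_of_deriv_nonpos (convex_Icc 0 1)
    · exact fun t _ => (hE t).continuousAt.continuousWithinAt
    · exact fun t _ => (hE t).differentiableAt.differentiableWithinAt
    · intro t ht
      rw [interior_Icc] at ht
      rw [(hE t).deriv]
      have := hode t ⟨ht.1.le, ht.2.le⟩
      have h3 : t * (2 * M1 t * (M2 t + k ^ 2 * M t)) = -(2 * m * M1 t ^ 2) := by
        linear_combination 2 * M1 t * this
      have h4 : 0 ≤ 2 * m * M1 t ^ 2 := by positivity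
      by_contra! hcon
      nlinarith [mul_pos ht.1 hcon]
  have hb : ∀ t ∈ Icc (0:ℝ) 1, ‖M1 t‖ ≤ k * |M 0| := by
    intro t ht
    have := hanti (left_mem_Icc.2 zero_le_one) ht ht.1
    simp only [h0] at this
    rw [Real.norm_eq_abs]
    refine abs_le_of_sq_le_sq ?_ (by positivity)
    rw [mul_pow, sq_abs]
    nlinarith [sq_nonneg (M t), sq_nonneg (k * M t)]
  have := (convex_Icc (0:ℝ) 1).norm_image_sub_le_of_norm_hasDerivWithin_le
    (fun t _ => (h1 t).hasDerivWithinAt) hb (left_mem_Icc.2 zero_le_one) (right_mem_Icc.2 zero_le_one)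
  simp at this
  have h5 := abs_sub_abs_le_abs_sub (M 0) (M 1)
  rw [abs_sub_comm] at h5
  linarith


theorem lh_integrable {E : Type*} [NormedAddCommGroup E] [MeasurableSpace E] [BorelSpace E]
    (μ : Measure E) [IsFiniteMeasure μ] (K : Set E) (hK : IsCompact K)
    (hμ : ∀ᵐ ω ∂μ, ω ∈ K) (g : E → ℝ) (hg : Continuous g) : Integrable g μ := by
  obtain ⟨C, hC⟩ := hK.exists_bound_of_continuousOn hg.continuousOn
  refine Integrable.of_bound hg.aestronglyMeasurable C ?_
  filter_upwards [hμ] with ω h using hC ω h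

theorem lh_diff {E : Type*} [NormedAddCommGroup E] [MeasurableSpace E] [BorelSpace E] [SecondCountableTopology E]
    (μ : Measure E) [IsFiniteMeasure μ] (K : Set E) (hK : IsCompact K)
    (hμ : ∀ᵐ ω ∂μ, ω ∈ K) (g g' : ℝ → E → ℝ) (hg : ∀ t, Continuous (g t))
    (hg' : Continuous (Function.uncurry g')) (hd : ∀ t ω, HasDerivAt (fun t => g t ω) (g' t ω) t)
    (t : ℝ) : HasDerivAt (fun t => ∫ ω, g t ω ∂μ) (∫ ω, g' t ω ∂μ) t := by
  obtain ⟨C, hC⟩ := ((isCompact_closedBall t 1).prod hK).exists_bound_of_continuousOn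
    hg'.continuousOn
  refine (hasDerivAt_integral_of_dominated_loc_of_deriv_le (μ := μ) (F := g) (F' := g')
    (bound := fun _ => C) (closedBall_mem_nhds t one_pos) ?_ ?_ ?_ ?_ ?_ ?_).2
  · exact Eventually.of_forall fun t => (hg t).aestronglyMeasurable
  · exact lh_integrable μ K hK hμ _ (hg t)
  · exact (hg'.comp (Continuous.prodMk_right t)).aestronglyMeasurable
  · filter_upwards [hμ] with ω h s hs using hC (s, ω) ⟨hs, h⟩
  · exact integrable_const C
  · exact Eventually.of_forall fun ω s _ => hd s ω

theorem lh_rot {n : ℕ} (μ : Measure (EuclideanSpace ℝ (Fin n))) [IsFiniteMeasure μ]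
    (K : Set (EuclideanSpace ℝ (Fin n))) (hK : IsCompact K) (hμ : ∀ᵐ ω ∂μ, ω ∈ K)
    (hinv : ∀ L : EuclideanSpace ℝ (Fin n) ≃ₗᵢ[ℝ] EuclideanSpace ℝ (Fin n), MeasurePreserving L μ μ)
    (g : EuclideanSpace ℝ (Fin n) → ℝ) (hg : ContDiff ℝ 1 g) (i j : Fin n) :
    ∫ ω, fderiv ℝ g ω (ω i • EuclideanSpace.single j 1 - ω j • EuclideanSpace.single i 1) ∂μ = 0 := by
  classical
  rcases eq_or_ne i j with rfl | hij
  · simp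
  set ei : EuclideanSpace ℝ (Fin n) := EuclideanSpace.single i 1 with hei
  set ej : EuclideanSpace ℝ (Fin n) := EuclideanSpace.single j 1 with hej
  have iei : ∀ x, inner ℝ ei x = x i := fun x => by simp [hei, EuclideanSpace.inner_single_left]
  have iej : ∀ x, inner ℝ ej x = x j := fun x => by simp [hej, EuclideanSpace.inner_single_left]
  let u : ℝ → EuclideanSpace ℝ (Fin n) := fun t => Real.cos t • ei + Real.sin t • ej
  let u' : ℝ → EuclideanSpace ℝ (Fin n) := fun t => (-Real.sin t) • ei + Real.cos t • ej
  have hu : ∀ t, ‖u t‖ = 1 := by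
    intro t
    have : ‖u t‖ ^ 2 = 1 := by
      rw [← real_inner_self_eq_norm_sq]
      simp only [u, inner_add_left, real_inner_smul_left, iei, iej]
      simp [hei, hej, hij, hij.symm]
      nlinarith [Real.sin_sq_add_cos_sq t]
    nlinarith [norm_nonneg (u t)]
  have hud : ∀ t, HasDerivAt u (u' t) t := fun t =>
    ((Real.hasDerivAt_cos t).smul_const ei).add ((Real.hasDerivAt_sin t).smul_const ej)
  have huc : Continuous u := by fun_prop
  have huc' : Continuous u' := by fun_prop
  let c : ℝ → EuclideanSpace ℝ (Fin n) → EuclideanSpace ℝ (Fin n) :=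
    fun t x => (2 * inner ℝ (u t) x) • u t - x
  let c' : ℝ → EuclideanSpace ℝ (Fin n) → EuclideanSpace ℝ (Fin n) :=
    fun t x => (2 * inner ℝ (u t) x) • u' t + (2 * inner ℝ (u' t) x) • u t
  let ρ : ℝ → (EuclideanSpace ℝ (Fin n) ≃ₗᵢ[ℝ] EuclideanSpace ℝ (Fin n)) :=
    fun t => Submodule.reflection (Submodule.span ℝ {u t})
  have hρ : ∀ t x, ρ t x = c t x := by
    intro t x
    simp only [ρ, c]
    rw [Submodule.reflection_singleton_apply, hu]
    simp [two_smul, two_mul, add_smul]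
  have hcd : ∀ x t, HasDerivAt (fun t => c t x) (c' t x) t := by
    intro x t
    have h1 : HasDerivAt (fun t => 2 * inner ℝ (u t) x) (2 * inner ℝ (u' t) x) t := by
      have := ((hud t).inner ℝ (hasDerivAt_const t x)).const_mul 2
      simpa using this
    exact (h1.smul (hud t)).sub_const x
  let p : EuclideanSpace ℝ (Fin n) → EuclideanSpace ℝ (Fin n) := fun x => c 0 x
  have hpc : Continuous p := by fun_prop
  have hder := lh_diff μ K hK hμ (fun t x => g (c t (p x)))
    (fun t x => fderiv ℝ g (c t (p x)) (c' t (p x)))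
    (by
      intro t
      have := hg.continuous
      fun_prop)
    (by
      have h1 : Continuous (fun q : ℝ × EuclideanSpace ℝ (Fin n) => c q.1 (p q.2)) := by fun_prop
      have h2 : Continuous (fun q : ℝ × EuclideanSpace ℝ (Fin n) => c' q.1 (p q.2)) := by fun_prop
      exact ((hg.continuous_fderiv one_ne_zero).comp h1).clm_apply h2)
    (by
      intro t x
      exact ((hg.differentiable one_ne_zero) _).hasFDerivAt.comp_hasDerivAt t (hcd (p x) t)) 0
  have hconst : (fun t => ∫ x, g (c t (p x)) ∂μ) = fun _ => ∫ x, g x ∂μ := by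
    funext t
    have h1 : ∀ x, g (c t (p x)) = g (((ρ 0).trans (ρ t)) x) := by
      intro x
      simp [p, hρ]
    simp_rw [h1]
    exact (hinv ((ρ 0).trans (ρ t))).integral_comp'
      (f := ((ρ 0).trans (ρ t)).toHomeomorph.toMeasurableEquiv) g
  rw [hconst] at hder
  have h0 := hder.unique (hasDerivAt_const 0 _)
  have h2 : ∀ x, fderiv ℝ g (c 0 (p x)) (c' 0 (p x)) = 2 * fderiv ℝ g x (x i • ej - x j • ei) := by
    intro x
    have e1 : c 0 (p x) = x := by
      rw [← hρ]
      simp only [p]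
      rw [← hρ]
      exact Submodule.reflection_reflection _ x
    have e2 : c' 0 (p x) = (2:ℝ) • (x i • ej - x j • ei) := by
      simp only [c', p, c, u, u']
      simp [iei, iej, inner_sub_right, real_inner_smul_right]
      simp [hei, hej, hij, hij.symm]
      module
    rw [e1, e2, map_smul, smul_eq_mul]
  simp_rw [h2] at h0
  rw [integral_const_mul] at h0
  linarith

theorem lh_alg {n : ℕ} (B : EuclideanSpace ℝ (Fin n) →L[ℝ] EuclideanSpace ℝ (Fin n) →L[ℝ] ℝ)
    (l : EuclideanSpace ℝ (Fin n) →L[ℝ] ℝ)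
    (A : Fin n → Fin n → EuclideanSpace ℝ (Fin n) →L[ℝ] EuclideanSpace ℝ (Fin n))
    (hA : ∀ i j x, A i j x = x i • EuclideanSpace.single j 1 - x j • EuclideanSpace.single i 1)
    (t : ℝ) (w : EuclideanSpace ℝ (Fin n)) :
    ∑ i, ∑ j, (t * B (A i j w) (A i j w) + l (A i j (A i j w)))
     = 2 * (t * ‖w‖ ^ 2 * ∑ i, B (EuclideanSpace.single i 1) (EuclideanSpace.single i 1)
        - t * B w w - ((n : ℝ) - 1) * l w) := by
  classical
  have hw : w = ∑ i, w i • EuclideanSpace.single i (1:ℝ) := by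
    ext k; simp [Finset.sum_apply, Pi.single_apply]
  have hl : l w = ∑ i, w i * l (EuclideanSpace.single i 1) := by
    conv_lhs => rw [hw]
    simp
  have hB : B w w = ∑ i, ∑ j, w i * w j * B (EuclideanSpace.single i 1) (EuclideanSpace.single j 1) := by
    conv_lhs => rw [hw]
    simp [Finset.mul_sum, mul_assoc]
    rw [Finset.sum_comm]
    exact Finset.sum_congr rfl fun i _ => Finset.sum_congr rfl fun j _ => by ring
  have hn : ‖w‖ ^ 2 = ∑ i, w i ^ 2 := by
    rw [EuclideanSpace.norm_sq_eq]; simp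
  have hBt : ∑ i, ∑ j, w i * w j * B (EuclideanSpace.single j 1) (EuclideanSpace.single i 1) = B w w := by
    rw [hB, Finset.sum_comm]
    simp_rw [mul_comm]
  have key : ∀ i j, t * B (A i j w) (A i j w) + l (A i j (A i j w)) =
      t * (w i ^ 2 * B (EuclideanSpace.single j 1) (EuclideanSpace.single j 1))
      + t * (w j ^ 2 * B (EuclideanSpace.single i 1) (EuclideanSpace.single i 1))
      - t * (w i * w j * B (EuclideanSpace.single i 1) (EuclideanSpace.single j 1))
      - t * (w i * w j * B (EuclideanSpace.single j 1) (EuclideanSpace.single i 1))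
      + 2 * (if i = j then w i * l (EuclideanSpace.single i 1) else 0)
      - w j * l (EuclideanSpace.single j 1) - w i * l (EuclideanSpace.single i 1) := by
    intro i j
    simp only [hA]
    by_cases hij : i = j
    · subst hij; simp; ring
    · simp [hij, Ne.symm hij, Pi.single_apply]
      ring
  simp_rw [key, Finset.sum_sub_distrib, Finset.sum_add_distrib, Finset.sum_sub_distrib,
    Finset.sum_add_distrib, ← Finset.mul_sum]
  rw [hBt, ← hB]
  simp [← Finset.mul_sum, ← Finset.sum_mul, ← hl, ← hn]
  have hs : ∑ x, (n:ℝ) * w x * l (EuclideanSpace.single x 1) = n * l w := by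
    rw [hl, Finset.mul_sum]
    exact Finset.sum_congr rfl fun i _ => by ring
  ring_nf
  rw [hs]
  ring

theorem lh_lap {n : ℕ} (f : EuclideanSpace ℝ (Fin n) → ℝ) (hf : ContDiff ℝ 2 f)
    (x : EuclideanSpace ℝ (Fin n)) :
    lap f x = ∑ i, fderiv ℝ (fderiv ℝ f) x (EuclideanSpace.single i 1) (EuclideanSpace.single i 1) := by
  have h1 : ContDiff ℝ 1 (fderiv ℝ f) := hf.fderiv_right (by norm_num)
  unfold lap
  refine Finset.sum_congr rfl fun i _ => ?_
  have := ((h1.differentiable one_ne_zero x).hasFDerivAt.clm_apply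
    (hasFDerivAt_const (EuclideanSpace.single i (1:ℝ)) x)).fderiv
  rw [this]
  simp

theorem lh_core {n : ℕ} (hn : 1 ≤ n) (μ : Measure (EuclideanSpace ℝ (Fin n))) [IsFiniteMeasure μ]
    (r lam : ℝ) (hr : 0 < r) (hlam : 0 < lam) (hμ : ∀ᵐ ω ∂μ, ω ∈ sphere 0 r)
    (hinv : ∀ L : EuclideanSpace ℝ (Fin n) ≃ₗᵢ[ℝ] EuclideanSpace ℝ (Fin n), MeasurePreserving L μ μ)
    (f : EuclideanSpace ℝ (Fin n) → ℝ) (hf : ContDiff ℝ 2 f)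
    (hlap : ∀ y ∈ closedBall 0 r, lap f y = -lam ^ 2 * f y) :
    (1 - lam * r) * |μ.real univ * f 0| ≤ |∫ ω, f ω ∂μ| := by
  have hK : IsCompact (sphere (0 : EuclideanSpace ℝ (Fin n)) r) := isCompact_sphere 0 r
  have hf1 : ContDiff ℝ 1 (fderiv ℝ f) := hf.fderiv_right (by norm_num)
  have hf2 : Continuous (fderiv ℝ (fderiv ℝ f)) := hf1.continuous_fderiv one_ne_zero
  have hfc := hf.continuous
  have hf1c := hf1.continuous
  have hfd : ∀ x, HasFDerivAt f (fderiv ℝ f x) x :=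
    fun x => (hf.differentiable two_ne_zero x).hasFDerivAt
  have hfd1 : ∀ x, HasFDerivAt (fderiv ℝ f) (fderiv ℝ (fderiv ℝ f) x) x :=
    fun x => (hf1.differentiable one_ne_zero x).hasFDerivAt
  have hsm : ∀ (x : EuclideanSpace ℝ (Fin n)) (t : ℝ), HasDerivAt (fun t : ℝ => t • x) x t := by
    intro x t
    simpa using (hasDerivAt_id t).smul_const x
  have h1 := lh_diff μ _ hK hμ (fun t x => f (t • x)) (fun t x => fderiv ℝ f (t • x) x)
    (fun t => by fun_prop) (by fun_prop)
    (fun t x => (hfd _).comp_hasDerivAt t (hsm x t))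
  have h2 := lh_diff μ _ hK hμ (fun t x => fderiv ℝ f (t • x) x)
    (fun t x => fderiv ℝ (fderiv ℝ f) (t • x) x x)
    (fun t => by fun_prop) (by fun_prop)
    (fun t x => by
      have := ((hfd1 _).comp_hasDerivAt t (hsm x t)).clm_apply (hasDerivAt_const t x)
      simpa using this)
  have h0 : ∫ x, fderiv ℝ f ((0:ℝ) • x) x ∂μ = 0 := by
    simp only [zero_smul]
    have := (hinv (LinearIsometryEquiv.neg ℝ)).integral_comp'
      (f := (LinearIsometryEquiv.neg ℝ).toHomeomorph.toMeasurableEquiv) (fun x => fderiv ℝ f 0 x)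
    have h3 : ∫ x, fderiv ℝ f 0 (-x) ∂μ = ∫ x, fderiv ℝ f 0 x ∂μ := this
    simp only [map_neg, integral_neg] at h3
    linarith
  let A : Fin n → Fin n → EuclideanSpace ℝ (Fin n) →L[ℝ] EuclideanSpace ℝ (Fin n) := fun i j =>
    (EuclideanSpace.proj i : EuclideanSpace ℝ (Fin n) →L[ℝ] ℝ).smulRight (EuclideanSpace.single j 1)
    - (EuclideanSpace.proj j : EuclideanSpace ℝ (Fin n) →L[ℝ] ℝ).smulRight (EuclideanSpace.single i 1)
  have hA : ∀ i j x, A i j x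
      = x i • EuclideanSpace.single j 1 - x j • EuclideanSpace.single i 1 := by
    intro i j x
    simp [A]
  have hode : ∀ t ∈ Icc (0:ℝ) 1, t * (∫ x, fderiv ℝ (fderiv ℝ f) (t • x) x x ∂μ)
      + ((n:ℝ) - 1) * (∫ x, fderiv ℝ f (t • x) x ∂μ)
      = -((lam * r) ^ 2 * t * ∫ x, f (t • x) ∂μ) := by
    intro t ht
    have hrot : ∀ i j, ∫ x, (t * fderiv ℝ (fderiv ℝ f) (t • x) (A i j x) (A i j x)
        + fderiv ℝ f (t • x) (A i j (A i j x))) ∂μ = 0 := by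
      intro i j
      have hg : ContDiff ℝ 1 (fun x => fderiv ℝ f (t • x) (A i j x)) := by
        have : ContDiff ℝ 1 (fun x : EuclideanSpace ℝ (Fin n) => t • x) := by fun_prop
        exact (hf1.comp this).clm_apply (A i j).contDiff
      rw [← lh_rot μ _ hK hμ hinv _ hg i j]
      congr 1
      funext x
      rw [← hA]
      have hs : HasFDerivAt (fun x : EuclideanSpace ℝ (Fin n) => t • x)
          (t • ContinuousLinearMap.id ℝ (EuclideanSpace ℝ (Fin n))) x :=
        (hasFDerivAt_id x).const_smul t
      have := (((hfd1 (t • x)).comp x hs).clm_apply ((A i j).hasFDerivAt (x := x))).fderiv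
      have e : fderiv ℝ (fun x => fderiv ℝ f (t • x) (A i j x)) x = _ := this
      rw [e]
      simp
      ring
    have hint : ∀ g : EuclideanSpace ℝ (Fin n) → ℝ, Continuous g → Integrable g μ :=
      fun g hg => lh_integrable μ _ hK hμ g hg
    have hsum : ∫ x, ∑ i, ∑ j, (t * fderiv ℝ (fderiv ℝ f) (t • x) (A i j x) (A i j x)
        + fderiv ℝ f (t • x) (A i j (A i j x))) ∂μ = 0 := by
      rw [integral_finsetSum _ (fun i _ => hint _ (by fun_prop))]
      refine Finset.sum_eq_zero fun i _ => ?_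
      rw [integral_finsetSum _ (fun j _ => hint _ (by fun_prop))]
      exact Finset.sum_eq_zero fun j _ => hrot i j
    have hae : ∀ᵐ x ∂μ, ∑ i, ∑ j, (t * fderiv ℝ (fderiv ℝ f) (t • x) (A i j x) (A i j x)
        + fderiv ℝ f (t • x) (A i j (A i j x))) =
        2 * (-((lam * r) ^ 2 * t) * f (t • x) - (t * fderiv ℝ (fderiv ℝ f) (t • x) x x
          + ((n:ℝ) - 1) * fderiv ℝ f (t • x) x)) := by
      filter_upwards [hμ] with x hx
      have hx' : ‖x‖ = r := by simpa using hx
      rw [lh_alg _ _ A hA, ← lh_lap f hf, hlap, hx']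
      · ring
      · rw [mem_closedBall_zero_iff, norm_smul, hx', Real.norm_eq_abs, abs_of_nonneg ht.1]
        nlinarith [ht.2]
    rw [integral_congr_ae hae, integral_const_mul, integral_sub, integral_add, integral_const_mul,
      integral_const_mul, integral_const_mul] at hsum
    · linarith
    all_goals exact hint _ (by fun_prop)
  have := lh_ode _ _ _ (lam * r) ((n:ℝ) - 1) (by positivity)
    (by have : (1:ℝ) ≤ n := by exact_mod_cast hn
        linarith) h1 h2 h0 hode
  simpa using this

theorem lh_sphere_pos (m : ℕ) :
    0 < (μH[(m:ℝ)] : Measure (EuclideanSpace ℝ (Fin (m+1)))) (sphere 0 1) := by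
  let P : EuclideanSpace ℝ (Fin (m+1)) → (Fin m → ℝ) := fun x i => x i.succ
  have hP : LipschitzWith 1 P := by
    apply LipschitzWith.of_dist_le_mul
    intro x y
    rw [NNReal.coe_one, one_mul, dist_pi_le_iff dist_nonneg]
    intro i
    simp only [P]
    rw [dist_eq_norm, dist_eq_norm]
    exact PiLp.norm_apply_le (x - y) i.succ
  have h := hP.hausdorffMeasure_image_le (d := (m:ℝ)) (by positivity) (sphere 0 1)
  have hsub : ball (0 : Fin m → ℝ) (1 / (m + 1)) ⊆ P '' sphere 0 1 := by
    intro y hy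
    have hm : (0:ℝ) < m + 1 := by positivity
    have hs : ∑ i, y i ^ 2 ≤ 1 := by
      have h1 : ∀ i, y i ^ 2 ≤ 1 / (m + 1) := by
        intro i
        have h2 : ‖y i‖ ≤ ‖y‖ := norm_le_pi_norm y i
        have h3 : ‖y‖ < 1 / (m + 1) := by simpa using hy
        have h4 : (1:ℝ) / (m + 1) ≤ 1 := by
          rw [div_le_one hm]; linarith [(Nat.cast_nonneg m : (0:ℝ) ≤ m)]
        rw [Real.norm_eq_abs] at h2
        rw [← sq_abs]
        nlinarith [abs_nonneg (y i)]
      calc ∑ i, y i ^ 2 ≤ ∑ i : Fin m, (1:ℝ) / (m + 1) := Finset.sum_le_sum fun i _ => h1 i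
        _ = m / (m + 1) := by simp; rfl
        _ ≤ 1 := by rw [div_le_one hm]; linarith
    refine ⟨WithLp.toLp 2 (Fin.cons (Real.sqrt (1 - ∑ i, y i ^ 2)) y), ?_, ?_⟩
    · rw [mem_sphere_zero_iff_norm, EuclideanSpace.norm_eq, Fin.sum_univ_succ]
      simp [Real.sq_sqrt (sub_nonneg.2 hs)]
    · funext i; simp [P]
  have hpos : 0 < (μH[(m:ℝ)] : Measure (Fin m → ℝ)) (ball 0 (1 / (m+1))) := by
    have := hausdorffMeasure_pi_real (ι := Fin m)
    rw [Fintype.card_fin] at this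
    rw [this]
    exact measure_ball_pos _ _ (by positivity)
  simp at h
  exact hpos.trans_le ((measure_mono hsub).trans (by simpa using h))

theorem lh_sphere_fin (m : ℕ) :
    (μH[(m:ℝ)] : Measure (EuclideanSpace ℝ (Fin (m+1)))) (sphere 0 1) < ⊤ := by
  let Q : Fin (m+1) → ℝ → (Fin m → ℝ) → EuclideanSpace ℝ (Fin (m+1)) :=
    fun i s y => WithLp.toLp 2 (i.insertNth s y)
  have hQ : ∀ i s, ContDiff ℝ 1 (Q i s) := by
    intro i s
    rw [contDiff_euclidean]
    intro j
    simp only [Q]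
    refine Fin.succAboveCases i ?_ (fun k => ?_) j
    · simpa using contDiff_const
    · simpa using contDiff_apply ℝ ℝ k
  have hQ0 : ∀ i s y, s ≠ 0 → Q i s y ≠ 0 := by
    intro i s y hs h
    have := congrArg (fun x : EuclideanSpace ℝ (Fin (m+1)) => x i) h
    simp [Q] at this
    exact hs this
  let F : Fin (m+1) → ℝ → (Fin m → ℝ) → EuclideanSpace ℝ (Fin (m+1)) :=
    fun i s y => ‖Q i s y‖⁻¹ • Q i s y
  have hF : ∀ i s, s ≠ 0 → ContDiff ℝ 1 (F i s) := by
    intro i s hs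
    have h1 : ContDiff ℝ 1 (fun y => ‖Q i s y‖) := (hQ i s).norm ℝ (fun y => hQ0 i s y hs)
    exact (h1.inv (fun y => norm_ne_zero_iff.2 (hQ0 i s y hs))).smul (hQ i s)
  let K : Set (Fin m → ℝ) := closedBall 0 1
  have hfin : ∀ i s, s ≠ 0 →
      (μH[(m:ℝ)] : Measure (EuclideanSpace ℝ (Fin (m+1)))) (F i s '' K) < ⊤ := by
    intro i s hs
    obtain ⟨C, hC⟩ : ∃ C, LipschitzOnWith C (F i s) K := 
      (hF i s hs).contDiffOn.exists_lipschitzOnWith one_ne_zero (convex_closedBall _ _) (isCompact_closedBall _ _)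
    refine (hC.hausdorffMeasure_image_le (d := (m:ℝ)) (by positivity)).trans_lt ?_
    have := hausdorffMeasure_pi_real (ι := Fin m)
    rw [Fintype.card_fin] at this
    rw [this]
    exact ENNReal.mul_lt_top (by simp) measure_closedBall_lt_top
  have hcov : sphere (0 : EuclideanSpace ℝ (Fin (m+1))) 1 ⊆ ⋃ i, (F i 1 '' K ∪ F i (-1) '' K) := by
    intro x hx
    have hx1 : ‖x‖ = 1 := by simpa using hx
    obtain ⟨i, -, hi⟩ := Finset.exists_max_image Finset.univ (fun i => |x i|) ⟨0, Finset.mem_univ _⟩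
    have hi0 : 0 < |x i| := by
      by_contra! hcon
      have : x = 0 := by
        ext j
        have := (hi j (Finset.mem_univ _)).trans hcon
        simpa using this
      rw [this] at hx1
      simp at hx1
    let y : Fin m → ℝ := fun k => x (i.succAbove k) / |x i|
    have hy : y ∈ K := by
      simp only [K, mem_closedBall_zero_iff]
      rw [pi_norm_le_iff_of_nonneg zero_le_one]
      intro k
      simp only [y, norm_div, Real.norm_eq_abs, abs_abs]
      rw [div_le_one hi0]
      exact hi _ (Finset.mem_univ _)
    have hq : Q i (x i / |x i|) y = |x i|⁻¹ • x := by
      ext j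
      simp only [Q]
      refine Fin.succAboveCases i ?_ (fun k => ?_) j
      · simp [div_eq_inv_mul]
      · simp [y, div_eq_inv_mul]
    have hFx : F i (x i / |x i|) y = x := by
      simp only [F]
      rw [hq, norm_smul, hx1, smul_smul]
      simp [hi0.ne', abs_pos.1 hi0]
    rw [mem_iUnion]
    refine ⟨i, ?_⟩
    rcases (abs_pos.1 hi0).lt_or_gt with h | h
    · right
      have : x i / |x i| = -1 := by rw [abs_of_neg h, div_neg, div_self h.ne]
      exact ⟨y, hy, by rw [← this]; exact hFx⟩
    · left
      have : x i / |x i| = 1 := by rw [abs_of_pos h, div_self h.ne']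
      exact ⟨y, hy, by rw [← this]; exact hFx⟩
  refine (measure_mono hcov).trans_lt ?_
  refine (measure_iUnion_fintype_le _ _).trans_lt ?_
  refine ENNReal.sum_lt_top.2 fun i _ => ?_
  exact (measure_union_le _ _).trans_lt
    (ENNReal.add_lt_top.2 ⟨hfin i 1 one_ne_zero, hfin i (-1) (by norm_num)⟩)

theorem lh_sphere_scale (m : ℕ) (r : ℝ) (hr : 0 < r) :
    (μH[(m:ℝ)] : Measure (EuclideanSpace ℝ (Fin (m+1)))).real (sphere 0 r) =
    r ^ m * (μH[(m:ℝ)] : Measure (EuclideanSpace ℝ (Fin (m+1)))).real (sphere 0 1) := by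
  have h := Measure.hausdorffMeasure_smul₀ (d := (m:ℝ)) (by positivity) hr.ne'
    (sphere (0 : EuclideanSpace ℝ (Fin (m+1))) 1)
  rw [smul_sphere' hr.ne'] at h
  simp [abs_of_pos hr] at h
  simp [Measure.real, h, ENNReal.smul_def, abs_of_pos hr]

theorem lh_cs {E : Type*} [MeasurableSpace E] (μ : Measure E) [IsFiniteMeasure μ] (f : E → ℝ)
    (hf : Integrable f μ) (hf2 : Integrable (fun x => f x ^ 2) μ) (hμ : 0 < μ.real univ) :
    (∫ x, f x ∂μ) ^ 2 ≤ μ.real univ * ∫ x, f x ^ 2 ∂μ := by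
  set a := (∫ x, f x ∂μ) / μ.real univ with ha
  have h0 : 0 ≤ ∫ x, (f x - a) ^ 2 ∂μ := integral_nonneg fun x => sq_nonneg _
  have h1 : ∫ x, (f x - a) ^ 2 ∂μ = (∫ x, f x ^ 2 ∂μ) - 2 * a * (∫ x, f x ∂μ) + a ^ 2 * μ.real univ := by
    have : ∀ x, (f x - a) ^ 2 = f x ^ 2 - 2 * a * f x + a ^ 2 := fun x => by ring
    simp_rw [this]
    have h3 : Integrable (fun x => f x ^ 2 - 2 * a * f x) μ := hf2.sub (hf.const_mul _)
    rw [integral_add h3 (integrable_const _),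
      integral_sub hf2 (hf.const_mul _), integral_const_mul, integral_const, smul_eq_mul]
    ring
  have h2 : ∫ x, f x ∂μ = a * μ.real univ := by rw [ha]; field_simp
  rw [h1] at h0
  rw [h2] at h0 ⊢
  nlinarith

theorem lh_cutoff {n : ℕ} (x₀ : EuclideanSpace ℝ (Fin n)) (r R lam : ℝ) (hr : 0 < r) (hR : r < R)
    (ψ : EuclideanSpace ℝ (Fin n) → ℝ) (hψ : ContDiffOn ℝ 2 ψ (ball x₀ R))
    (hlap : ∀ y ∈ ball x₀ R, lap ψ y = -lam ^ 2 * ψ y) :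
    ∃ f : EuclideanSpace ℝ (Fin n) → ℝ, ContDiff ℝ 2 f ∧
      (∀ y ∈ closedBall 0 r, f y = ψ (x₀ + y)) ∧
      (∀ y ∈ closedBall 0 r, lap f y = -lam ^ 2 * f y) := by
  obtain ⟨a, ha1, ha2⟩ := exists_between hR
  obtain ⟨b, hb1, hb2⟩ := exists_between ha2
  let χ : ContDiffBump (0 : EuclideanSpace ℝ (Fin n)) := ⟨a, b, hr.trans ha1, hb1⟩
  let φ : EuclideanSpace ℝ (Fin n) → ℝ := fun y => ψ (x₀ + y)
  have hev : ∀ y ∈ closedBall (0 : EuclideanSpace ℝ (Fin n)) r,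
      (fun y => χ y * φ y) =ᶠ[nhds y] φ := by
    intro y hy
    have : ball (0 : EuclideanSpace ℝ (Fin n)) a ∈ nhds y :=
      isOpen_ball.mem_nhds (closedBall_subset_ball ha1 hy)
    filter_upwards [this] with z hz
    rw [χ.one_of_mem_closedBall (ball_subset_closedBall hz), one_mul]
  refine ⟨fun y => χ y * φ y, ?_, fun y hy => (hev y hy).eq_of_nhds, ?_⟩
  · rw [contDiff_iff_contDiffAt]
    intro y
    by_cases hy : y ∈ ball (0 : EuclideanSpace ℝ (Fin n)) R
    · have h1 : ContDiffAt ℝ 2 ψ (x₀ + y) := by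
        refine hψ.contDiffAt (isOpen_ball.mem_nhds ?_)
        simpa using hy
      have h2 : ContDiffAt ℝ 2 φ y :=
        h1.comp y (by fun_prop : ContDiffAt ℝ 2 (fun y => x₀ + y) y)
      exact χ.contDiffAt.mul h2
    · have h3 : y ∉ tsupport χ := by
        rw [χ.tsupport_eq]
        exact fun h => hy (closedBall_subset_ball hb2 h)
      have h4 : (fun y => χ y * φ y) =ᶠ[nhds y] fun _ => 0 := by
        filter_upwards [notMem_tsupport_iff_eventuallyEq.1 h3] with z hz
        rw [hz]; simp
      exact contDiffAt_const.congr_of_eventuallyEq h4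
  · intro y hy
    have h1 : lap (fun y => χ y * φ y) y = lap φ y := by
      unfold lap
      refine Finset.sum_congr rfl fun i _ => ?_
      have : (fun z => fderiv ℝ (fun y => χ y * φ y) z (EuclideanSpace.single i 1))
          =ᶠ[nhds y] fun z => fderiv ℝ φ z (EuclideanSpace.single i 1) := by
        filter_upwards [(hev y hy).fderiv (𝕜 := ℝ)] with z hz
        rw [hz]
      rw [this.fderiv_eq]
    have h2 : lap φ y = lap ψ (x₀ + y) := by
      unfold lap
      refine Finset.sum_congr rfl fun i _ => ?_
      simp only [φ, fderiv_comp_add_left]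
      rw [fderiv_comp_add_left (f := fun z => fderiv ℝ ψ z (EuclideanSpace.single i 1))]
    rw [h1, h2, hlap]
    · simp only
      rw [(hev y hy).eq_of_nhds]
    · have := closedBall_subset_ball hR hy
      simpa using this

/-- Local Hörmander-type bound from restriction to a small sphere
(`L²` version).  For every `n ≥ 2` there are `κ, C > 0` depending only on `n`
such that for all `λ > 0`, `x₀ ∈ ℝⁿ`, `R > κ/λ`, and `ψ` of class `C²` on
`B_R(x₀)` with `Δψ = -λ²ψ` there,
`|ψ(x₀)| ≤ C · λ^((n-1)/2) · (∫_{∂B_{κ/λ}(x₀)} ψ² dσ)^(1/2)`. -/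
theorem local_hormander_L2
    (n : ℕ) (hn : 2 ≤ n) :
    ∃ κ C : ℝ, 0 < κ ∧ 0 < C ∧
      ∀ lam : ℝ, 0 < lam → ∀ x₀ : EuclideanSpace ℝ (Fin n), ∀ R : ℝ, κ / lam < R →
        ∀ ψ : EuclideanSpace ℝ (Fin n) → ℝ,
          ContDiffOn ℝ 2 ψ (ball x₀ R) →
          (∀ y ∈ ball x₀ R, lap ψ y = -lam ^ 2 * ψ y) →
          |ψ x₀| ≤ C * lam ^ (((n : ℝ) - 1) / 2)
            * (∫ y in sphere x₀ (κ / lam), ψ y ^ 2 ∂(μH[(n : ℝ) - 1])) ^ ((1 : ℝ) / 2) := by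
  obtain ⟨m, rfl⟩ : ∃ m, n = m + 1 := ⟨n - 1, by omega⟩
  have hm : ((m + 1 : ℕ) : ℝ) - 1 = m := by push_cast; ring
  rw [hm]
  set σ := (μH[(m:ℝ)] : Measure (EuclideanSpace ℝ (Fin (m+1)))).real (sphere 0 1) with hσ
  have hσ0 : 0 < σ := ENNReal.toReal_pos (lh_sphere_pos m).ne' (lh_sphere_fin m).ne
  refine ⟨1 / 2, Real.sqrt (4 / ((1 / 2) ^ m * σ)), by norm_num, by positivity, ?_⟩
  intro lam hlam x₀ R hR ψ hψ hlap
  set r := 1 / 2 / lam with hrdef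
  have hr : 0 < r := by positivity
  have hS := lh_sphere_scale m r hr
  rw [← hσ] at hS
  have hSpos : 0 < r ^ m * σ := by positivity
  obtain ⟨f, hf, hfψ, hflap⟩ := lh_cutoff x₀ r R lam hr hR ψ hψ hlap
  let μ : Measure (EuclideanSpace ℝ (Fin (m+1))) := (μH[(m:ℝ)]).restrict (sphere 0 r)
  have hμuniv : μ.real univ = r ^ m * σ := by
    rw [← hS]; simp [μ, Measure.real]
  haveI : IsFiniteMeasure μ := by
    constructor
    rw [lt_top_iff_ne_top]
    intro h
    simp [Measure.real, h] at hμuniv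
    rcases hμuniv with h | h
    · exact hr.ne' h.1
    · exact hσ0.ne' h
  have hae : ∀ᵐ ω ∂μ, ω ∈ sphere 0 r := ae_restrict_mem isClosed_sphere.measurableSet
  have hinv : ∀ L : EuclideanSpace ℝ (Fin (m+1)) ≃ₗᵢ[ℝ] EuclideanSpace ℝ (Fin (m+1)),
      MeasurePreserving L μ μ := by
    intro L
    have h1 := (L.toIsometryEquiv.measurePreserving_hausdorffMeasure (m:ℝ)).restrict_preimage
      (s := sphere 0 r) isClosed_sphere.measurableSet
    have h2 : L.toIsometryEquiv ⁻¹' sphere 0 r = sphere 0 r := by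
      ext x; simp
    rw [h2] at h1
    exact h1
  have hcore := lh_core (by omega) μ r lam hr hlam hae hinv f hf hflap
  have hK : IsCompact (sphere (0 : EuclideanSpace ℝ (Fin (m+1))) r) := isCompact_sphere 0 r
  have hcs := lh_cs μ f (lh_integrable μ _ hK hae f hf.continuous)
    (lh_integrable μ _ hK hae _ (hf.continuous.pow 2)) (by rw [hμuniv]; exact hSpos)
  have hJ : ∫ y in sphere x₀ r, ψ y ^ 2 ∂(μH[(m:ℝ)]) = ∫ x, f x ^ 2 ∂μ := by
    have h1 := (IsometryEquiv.addLeft x₀).measurePreserving_hausdorffMeasure (m:ℝ)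
    have h2 := h1.setIntegral_preimage_emb
      (IsometryEquiv.addLeft x₀).toHomeomorph.measurableEmbedding (fun y => ψ y ^ 2) (sphere x₀ r)
    rw [← h2]
    have h3 : IsometryEquiv.addLeft x₀ ⁻¹' sphere x₀ r = sphere 0 r := by
      ext x; simp
    rw [h3]
    refine setIntegral_congr_fun isClosed_sphere.measurableSet fun x hx => ?_
    simp [hfψ x (sphere_subset_closedBall hx)]
  rw [hJ]
  set J := ∫ x, f x ^ 2 ∂μ with hJdef
  have hJ0 : 0 ≤ J := integral_nonneg fun x => sq_nonneg _
  have hf0 : f 0 = ψ x₀ := by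
    have := hfψ 0 (by simp [hr.le])
    simpa using this
  have hk : lam * r = 1 / 2 := by rw [hrdef]; field_simp
  rw [hk, hμuniv, hf0, abs_mul, abs_of_pos hSpos] at hcore
  rw [hμuniv] at hcs
  have hmain : r ^ m * σ * ψ x₀ ^ 2 ≤ 4 * J := by
    have h1 : ((1 - 1 / 2) * (r ^ m * σ * |ψ x₀|)) ^ 2 ≤ r ^ m * σ * J := by
      refine le_trans ?_ hcs
      rw [← sq_abs (∫ x, f x ∂μ)]
      gcongr
    have h2 : (r ^ m * σ) * (r ^ m * σ * ψ x₀ ^ 2) ≤ (r ^ m * σ) * (4 * J) := by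
      rw [mul_pow, mul_pow, sq_abs] at h1
      nlinarith
    exact le_of_mul_le_mul_left h2 hSpos
  apply abs_le_of_sq_le_sq _ (by positivity)
  rw [mul_pow, mul_pow, Real.sq_sqrt (by positivity), ← Real.sqrt_eq_rpow, Real.sq_sqrt hJ0,
    ← Real.rpow_natCast (lam ^ ((m:ℝ) / 2)) 2, ← Real.rpow_mul hlam.le]
  have e : (m:ℝ) / 2 * ((2:ℕ):ℝ) = m := by push_cast; ring
  rw [e, Real.rpow_natCast]
  have e2 : r ^ m = (1 / 2) ^ m / lam ^ m := by rw [hrdef, div_pow]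
  rw [e2] at hmain
  have e3 : 4 / ((1 / 2) ^ m * σ) * lam ^ m * J = (4 * J) / ((1 / 2) ^ m / lam ^ m * σ) := by
    field_simp
  rw [e3, le_div_iff₀ (by positivity)]
  linarith
end
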